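/- arXiv:2601.12121 — 9 statements merged into one kernel-verified Lean document; each statement's English description precedes it below -/
import Mathlib

section
/- Fix ε > 0, M > 1, and a weight vector u ∈ (0,1)^d. Let x ∈ ℝ^d be such that ‖sx − r‖_u ≥ ε/s for every (r,s) ∈ ℤ^d × ℕ with 1 ≤ s < M. Then for every β > ε^{−1} there exists (p,q) ∈ ℤ^d × ℕ such that (1) M ≤ q ≤ Mβ, and (2) |x_i − p_i/q| ≤ M^{−(1+u_i)} β^{−u_i} for all i = 1,…,d. -/
open Real Set

/-- The weighted norm `‖x‖_u = max_i |x_i|^(1/u_i)`. -/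
noncomputable def wNorm {d : ℕ} (u : Fin d → ℝ) (x : Fin d → ℝ) : ℝ :=
  ⨆ i, |x i| ^ (1 / u i)

theorem weighted_minkowski (d : ℕ) (x a : Fin d → ℝ) (T : ℝ) (ha : ∀ i, 0 < a i) (hT : 0 < T)
    (h : 1 < T * ∏ i, a i) :
    ∃ (q : ℤ) (p : Fin d → ℤ), (q ≠ 0 ∨ p ≠ 0) ∧ |(q : ℝ)| < T ∧
      ∀ i, |(q : ℝ) * x i - p i| ≤ a i := by
  classical
  let A : Matrix (Fin (d + 1)) (Fin (d + 1)) ℝ :=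
    fun i j => Fin.cases (if j = 0 then 1 else 0)
      (fun k => Fin.cases (x k) (fun l => if k = l then -1 else 0) j) i
  have hdet : |A.det| = 1 := by
    rw [Matrix.det_of_lowerTriangular]
    · rw [Fin.prod_univ_succ]
      simp [A]
    · intro i j hij
      induction i using Fin.cases with
      | zero =>
        have : j ≠ 0 := by
          intro h0
          subst h0
          simp at hij
        simp [A, this]
      | succ k =>
        induction j using Fin.cases with
        | zero =>
          exact absurd (OrderDual.toDual_lt_toDual.1 hij) (by simp)
        | succ l =>
          have : k ≠ l := by
            intro h0
            subst h0
            simp at hij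
          simp [A, this]
  let f := Matrix.toLin' A
  have hf0 : ∀ v, f v 0 = v 0 := by
    intro v
    simp only [f, Matrix.toLin'_apply, Matrix.mulVec, dotProduct, Fin.sum_univ_succ]
    simp [A]
  have hfs : ∀ v k, f v (Fin.succ k) = v 0 * x k - v k.succ := by
    intro v k
    simp only [f, Matrix.toLin'_apply, Matrix.mulVec, dotProduct, Fin.sum_univ_succ]
    simp [A]
    ring
  let B : Set (Fin (d + 1) → ℝ) := Set.pi univ
    (fun i => Fin.cases (Ioo (-T) T) (fun k => Icc (-(a k)) (a k)) i)
  have hB : ∀ v, v ∈ B ↔ |v 0| < T ∧ ∀ k : Fin d, |v k.succ| ≤ a k := by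
    intro v
    simp [B, Set.mem_pi, Fin.forall_fin_succ, abs_lt, abs_le]
  have hBvol : MeasureTheory.volume B = ENNReal.ofReal ((2 * T) * ∏ i, (2 * a i)) := by
    simp only [B]
    rw [MeasureTheory.volume_pi_pi, Fin.prod_univ_succ]
    simp only [Fin.cases_zero, Fin.cases_succ, Real.volume_Ioo, Real.volume_Icc]
    rw [ENNReal.ofReal_mul (by positivity),
      ENNReal.ofReal_prod_of_nonneg (fun i _ => by have := ha i; positivity)]
    congr 1
    · congr 1; ring
    · refine Finset.prod_congr rfl fun i _ => ?_
      congr 1; ring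
  let S := f ⁻¹' B
  have hSvol : MeasureTheory.volume S = ENNReal.ofReal ((2 * T) * ∏ i, (2 * a i)) := by
    have hd : LinearMap.det f = A.det := LinearMap.det_toLin' A
    have hne : LinearMap.det f ≠ 0 := by
      rw [hd]; intro h0; simp [h0] at hdet
    simp only [S]
    rw [MeasureTheory.Measure.addHaar_preimage_linearMap _ hne, hd, abs_inv, hdet, hBvol]
    simp
  have hsymm : ∀ v ∈ S, -v ∈ S := by
    intro v hv
    simp only [S, mem_preimage, hB, map_neg, Pi.neg_apply, abs_neg] at hv ⊢
    exact hv
  have hconvB : Convex ℝ B := by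
    apply convex_pi
    intro i _
    induction i using Fin.cases with
    | zero => exact convex_Ioo _ _
    | succ k => exact convex_Icc _ _
  have hconv : Convex ℝ S := hconvB.linear_preimage f
  let b := Pi.basisFun ℝ (Fin (d + 1))
  have hfund := ZSpan.isAddFundamentalDomain b MeasureTheory.volume
  have hvol1 : MeasureTheory.volume (ZSpan.fundamentalDomain b) = 1 := by
    rw [ZSpan.fundamentalDomain_pi_basisFun, MeasureTheory.volume_pi_pi]
    simp
  have hlt : MeasureTheory.volume (ZSpan.fundamentalDomain b) *
      2 ^ Module.finrank ℝ (Fin (d + 1) → ℝ) < MeasureTheory.volume S := by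
    rw [hvol1, hSvol, one_mul, Module.finrank_fin_fun, Finset.prod_mul_distrib]
    simp only [Finset.prod_const, Finset.card_univ, Fintype.card_fin]
    have : (2 : ENNReal) ^ (d + 1) = ENNReal.ofReal (2 ^ (d + 1)) := by
      rw [ENNReal.ofReal_pow (by norm_num)]; simp
    rw [this]
    apply (ENNReal.ofReal_lt_ofReal_iff_of_nonneg (by positivity)).2
    have h2 : (0 : ℝ) < 2 ^ (d + 1) := by positivity
    have h3 := mul_lt_mul_of_pos_left h h2
    calc _ = (2 : ℝ) ^ (d + 1) * 1 := by ring
      _ < _ := h3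
      _ = _ := by ring
  haveI : Countable (Submodule.span ℤ (Set.range b)).toAddSubgroup :=
    inferInstanceAs (Countable (Submodule.span ℤ (Set.range b)))
  obtain ⟨v, hv0, hvS⟩ :=
    MeasureTheory.exists_ne_zero_mem_lattice_of_measure_mul_two_pow_lt_measure
      (L := (Submodule.span ℤ (Set.range b)).toAddSubgroup) hfund hsymm hconv hlt
  have hvm : (v : Fin (d + 1) → ℝ) ∈ Submodule.span ℤ (Set.range b) := v.2
  rw [Module.Basis.mem_span_iff_repr_mem] at hvm
  choose w hw using hvm
  have hw' : ∀ i, (v : Fin (d + 1) → ℝ) i = w i := by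
    intro i
    have := hw i
    simp [b] at this
    exact this.symm
  simp only [S, mem_preimage, hB, hf0, hfs, hw'] at hvS
  refine ⟨w 0, fun k => w k.succ, ?_, hvS.1, hvS.2⟩
  by_contra hcon
  push Not at hcon
  apply hv0
  ext i
  rw [hw']
  induction i using Fin.cases with
  | zero => simp [hcon.1]
  | succ k =>
    have := congrFun hcon.2 k
    simp at this
    simp [this]

theorem rational_in_window (d : ℕ) (hd : 1 ≤ d) (ε M : ℝ) (hε : 0 < ε) (hM : 1 < M)
    (u : Fin d → ℝ) (hu0 : ∀ i, 0 < u i) (hu1 : ∀ i, u i < 1) (humono : Monotone u)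
    (husum : ∑ i, u i = 1) (x : Fin d → ℝ)
    (hx : ∀ (r : Fin d → ℤ) (s : ℕ), 1 ≤ s → (s : ℝ) < M →
      ε / (s : ℝ) ≤ wNorm u (fun i => (s : ℝ) * x i - (r i : ℝ))) :
    ∀ β : ℝ, ε⁻¹ < β →
      ∃ (p : Fin d → ℤ) (q : ℕ), M ≤ (q : ℝ) ∧ (q : ℝ) ≤ M * β ∧
        ∀ i, |x i - (p i : ℝ) / (q : ℝ)| ≤ M ^ (-(1 + u i)) * β ^ (-(u i)) := by
  intro β hβ
  haveI : Nonempty (Fin d) := ⟨⟨0, hd⟩⟩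
  have hε1 : ε ≤ 1 := by
    have h1 := hx (fun i => round (x i)) 1 le_rfl (by simpa using hM)
    simp only [Nat.cast_one, div_one, one_mul] at h1
    refine h1.trans (ciSup_le fun i => ?_)
    apply Real.rpow_le_one (abs_nonneg _)
    · have := abs_sub_round (x i)
      linarith
    · have := hu0 i
      positivity
  have hβ1 : 1 < β := lt_of_le_of_lt ((one_le_inv₀ hε).2 hε1) hβ
  have hM0 : 0 < M := by linarith
  have hβ0 : 0 < β := by linarith
  have hMβ : 1 < M * β := by nlinarith
  have hMβ0 : 0 < M * β := by linarith
  obtain ⟨q, p, hne, hq, hp⟩ := weighted_minkowski d x (fun i => (M * β) ^ (-(u i)))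
    ((⌊M * β⌋₊ : ℝ) + 1) (fun i => Real.rpow_pos_of_pos hMβ0 _) (by positivity) (by
      rw [← Real.rpow_sum_of_pos hMβ0, Finset.sum_neg_distrib, husum, Real.rpow_neg_one,
        ← div_eq_mul_inv, one_lt_div hMβ0]
      exact Nat.lt_floor_add_one _)
  have hq0 : q ≠ 0 := by
    intro h0
    rcases hne with h | h
    · exact h h0
    · apply h
      funext i
      have h1 := hp i
      have h2 : (M * β) ^ (-(u i)) < 1 :=
        Real.rpow_lt_one_of_one_lt_of_neg hMβ (by have := hu0 i; linarith)
      have h3 := h1.trans_lt h2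
      simp only [h0, Int.cast_zero, zero_mul, zero_sub, abs_neg] at h3
      have h4 : |p i| < 1 := by exact_mod_cast h3
      exact Int.abs_lt_one_iff.1 h4
  -- normalise the sign
  obtain ⟨n, r, hn1, hn, hr⟩ : ∃ (n : ℕ) (r : Fin d → ℤ), 1 ≤ n ∧ (n : ℝ) ≤ M * β ∧
      ∀ i, |(n : ℝ) * x i - r i| ≤ (M * β) ^ (-(u i)) := by
    have hle : (q.natAbs : ℝ) ≤ M * β := by
      have h1 : ((q.natAbs : ℕ) : ℝ) = |(q : ℝ)| := by
        rw [Nat.cast_natAbs, Int.cast_abs]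
      rw [← h1] at hq
      have h2 : q.natAbs < ⌊M * β⌋₊ + 1 := by exact_mod_cast hq
      exact (Nat.le_floor_iff hMβ0.le).1 (Nat.lt_succ_iff.1 h2)
    refine ⟨q.natAbs, fun i => q.sign * p i, Int.natAbs_pos.2 hq0, hle, fun i => ?_⟩
    have h1 := hp i
    rcases lt_or_gt_of_ne hq0 with h | h
    · rw [Nat.cast_natAbs, abs_of_neg h, Int.sign_eq_neg_one_of_neg h]
      push_cast
      rw [← abs_neg]
      convert h1 using 2
      ring
    · rw [Nat.cast_natAbs, abs_of_pos h, Int.sign_eq_one_of_pos h]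
      simpa using h1
  have hnpos : (0 : ℝ) < n := by exact_mod_cast hn1
  have hMn : M ≤ n := by
    by_contra hlt
    push Not at hlt
    have h1 := hx r n hn1 hlt
    have h2 : wNorm u (fun i => (n : ℝ) * x i - (r i : ℝ)) ≤ (M * β)⁻¹ := by
      refine ciSup_le fun i => ?_
      have hu := hu0 i
      calc |(n : ℝ) * x i - r i| ^ (1 / u i) ≤ ((M * β) ^ (-(u i))) ^ (1 / u i) :=
            Real.rpow_le_rpow (abs_nonneg _) (hr i) (by positivity)
        _ = (M * β)⁻¹ := by
            rw [← Real.rpow_mul hMβ0.le, ← Real.rpow_neg_one]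
            congr 1
            field_simp
    have h3 := h1.trans h2
    have h4 : 1 < ε * β := by
      rw [inv_lt_iff_one_lt_mul₀ hε] at hβ
      linarith
    rw [div_le_iff₀ hnpos, ← div_eq_inv_mul, le_div_iff₀ hMβ0] at h3
    nlinarith
  refine ⟨r, n, hMn, hn, fun i => ?_⟩
  have h1 : x i - (r i : ℝ) / n = (n * x i - r i) / n := by field_simp
  rw [h1, abs_div, abs_of_pos hnpos, neg_add, Real.rpow_add hM0, Real.rpow_neg_one, mul_assoc,
    ← Real.mul_rpow hM0.le hβ0.le, ← div_eq_inv_mul]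
  exact div_le_div₀ (Real.rpow_pos_of_pos hMβ0 _).le (hr i) hM0 hMn
end

section
/- Fix R > 1, n ∈ ℕ, and a weight vector u ∈ (0,1)^d. For i = 1,…,d set ρ_0^{(i)} := R^{−(1+u_i)}/(d+1)!. Let E ⊂ ℝ^d be an axis-parallel box whose side length in the i-th coordinate direction is at most ρ_0^{(i)} R^{−(1+u_i)n}. Then for every 0 < ε < R^{−1}((d+1)!)^{−1/u_1}, the set S(E,ε) := { r/s ∈ ℚ^d : (r,s) ∈ ℤ^d × ℕ, R^n ≤ s < R^{n+1}, and ‖sx − r‖_u ≤ ε/s for some x ∈ E } is contained in an affine hyperplane of ℝ^d. -/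
open Real Set

lemma det_bound_aux {m : ℕ} (M : Matrix (Fin m) (Fin m) ℝ) (B : Fin m → ℝ)
    (h : ∀ i j, |M i j| ≤ B j) : |M.det| ≤ (Nat.factorial m : ℝ) * ∏ j, B j := by
  rw [Matrix.det_apply]
  refine (Finset.abs_sum_le_sum_abs _ _).trans ?_
  have : ∀ σ ∈ (Finset.univ : Finset (Equiv.Perm (Fin m))),
      |Equiv.Perm.sign σ • ∏ i, M (σ i) i| ≤ ∏ j, B j := by
    intro σ _
    have e : |Equiv.Perm.sign σ • ∏ i, M (σ i) i| = ∏ i, |M (σ i) i| := by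
      rcases Int.units_eq_one_or (Equiv.Perm.sign σ) with h | h <;>
        simp [h, Finset.abs_prod]
    rw [e]
    exact Finset.prod_le_prod (fun _ _ => abs_nonneg _) (fun i _ => h _ _)
  refine (Finset.sum_le_card_nsmul _ _ _ this).trans ?_
  simp [Fintype.card_perm]

lemma functional_aux {m : ℕ} (T : Set (Fin m → ℝ))
    (h : ∀ f : Fin m → Fin m → ℝ, (∀ k, f k ∈ T) → (Matrix.of f).det = 0) :
    ∃ w : Fin m → ℝ, w ≠ 0 ∧ ∀ x ∈ T, ∑ i, w i * x i = 0 := by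
  have hT : Submodule.span ℝ T < ⊤ := by
    rw [lt_top_iff_ne_top]
    intro htop
    let bs := Module.Basis.ofSpan (K := ℝ) (s := T) htop.ge
    have hc : Module.finrank ℝ (Fin m → ℝ) = m := by simp
    have : Fintype _ := Module.Basis.fintypeIndexOfRankLtAleph0 bs
      (by rw [← Module.finrank_eq_rank]; exact Cardinal.natCast_lt_aleph0)
    have hcard := Module.finrank_eq_card_basis bs
    rw [hc] at hcard
    let e := Fintype.equivFinOfCardEq hcard.symm
    let b' := bs.reindex e
    have h0 := h (fun k => b' k) (fun k => by
      apply Module.Basis.ofSpan_subset (K := ℝ) htop.ge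
      rw [Module.Basis.reindex_apply]
      exact Set.mem_range_self _)
    have hu := Matrix.linearIndependent_rows_iff_isUnit.mp
      (show LinearIndependent ℝ (Matrix.of (fun k => b' k)).row from b'.linearIndependent)
    rw [Matrix.isUnit_iff_isUnit_det, h0] at hu
    simp at hu
  obtain ⟨f, hf, hle⟩ := Submodule.exists_le_ker_of_lt_top _ hT
  have hfx : ∀ x, f x = ∑ i, f (Pi.single i 1) * x i := by
    intro x
    conv_lhs => rw [pi_eq_sum_univ' x, map_sum]
    refine Finset.sum_congr rfl fun i _ => ?_
    rw [map_smul, smul_eq_mul, mul_comm]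
  refine ⟨fun i => f (Pi.single i 1), ?_, ?_⟩
  · intro h0
    apply hf
    ext x
    have hz : ∀ i, f (Pi.single i 1) = 0 := fun i => congrFun h0 i
    simp [hz]
  · intro x hx
    rw [← hfx]
    exact hle (Submodule.subset_span hx)

lemma const_aux (d : ℕ) (hd : 2 ≤ d) :
    (Nat.factorial (d + 1) : ℝ) * (2 / (Nat.factorial (d + 1) : ℝ)) ^ d < 1 := by
  have hN : (6 : ℝ) ≤ (Nat.factorial (d + 1) : ℝ) := by
    have : Nat.factorial 3 ≤ Nat.factorial (d + 1) := Nat.factorial_le (by omega)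
    exact_mod_cast this
  set N := (Nat.factorial (d + 1) : ℝ)
  have h0 : 0 ≤ 2 / N := by positivity
  have h1 : 2 / N ≤ 1 / 3 := by
    rw [div_le_div_iff₀] <;> linarith
  calc N * (2 / N) ^ d ≤ N * (2 / N) ^ 2 := by
        gcongr N * ?_
        exact pow_le_pow_of_le_one h0 (by linarith) hd
    _ = 2 * (2 / N) := by field_simp
    _ < 1 := by linarith

lemma coord_aux (R : ℝ) (hR : 1 < R) (n : ℕ) (N : ℝ) (hN : 1 ≤ N) (u0 ui : ℝ) (hu0 : 0 < u0)
    (hle : u0 ≤ ui) (ε : ℝ) (hε0 : 0 < ε) (hε1 : ε < R⁻¹ * N ^ (-(1 / u0)))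
    (s : ℝ) (hs1 : R ^ (n : ℝ) ≤ s) (hs2 : s < R ^ ((n : ℝ) + 1)) (a b x r : ℝ)
    (hab : b - a ≤ (R ^ (-(1 + ui)) / N) * R ^ (-(1 + ui) * (n : ℝ)))
    (hx1 : a ≤ x) (hx2 : x ≤ b) (h : |s * x - r| ^ (1 / ui) ≤ ε / s) :
    |r - s * a| ≤ 2 / N * R ^ (-((n : ℝ) + 1) * ui) := by
  have hR0 : 0 < R := by linarith
  have hui : 0 < ui := by linarith
  have hN0 : 0 < N := by linarith
  have hs0 : 0 < s := lt_of_lt_of_le (by positivity) hs1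
  have h1 : |s * x - r| ≤ 1 / N * R ^ (-((n : ℝ) + 1) * ui) := by
    have e1 : |s * x - r| ≤ (ε / s) ^ ui := by
      have := Real.rpow_le_rpow (by positivity) h hui.le
      rwa [← Real.rpow_mul (abs_nonneg _), one_div_mul_cancel hui.ne', Real.rpow_one] at this
    have e2 : ε / s ≤ N ^ (-(1 / u0)) * R ^ (-((n : ℝ) + 1)) := by
      calc ε / s ≤ (R⁻¹ * N ^ (-(1 / u0))) / R ^ (n : ℝ) := by gcongr
        _ = _ := by
          rw [Real.rpow_neg hR0.le, Real.rpow_add hR0, Real.rpow_one]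
          field_simp
    have e3 := Real.rpow_le_rpow (by positivity) e2 hui.le
    refine e1.trans (e3.trans ?_)
    rw [Real.mul_rpow (by positivity) (by positivity), ← Real.rpow_mul hR0.le,
      ← Real.rpow_mul hN0.le]
    gcongr
    rw [show 1 / N = N ^ (-1 : ℝ) by rw [Real.rpow_neg_one, one_div]]
    apply Real.rpow_le_rpow_of_exponent_le hN
    have : 1 ≤ ui / u0 := by rwa [le_div_iff₀ hu0, one_mul]
    have e : -(1 / u0) * ui = -(ui / u0) := by ring
    rw [e]; linarith
  have h2 : s * (x - a) ≤ 1 / N * R ^ (-((n : ℝ) + 1) * ui) := by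
    calc s * (x - a) ≤ R ^ ((n : ℝ) + 1) *
          ((R ^ (-(1 + ui)) / N) * R ^ (-(1 + ui) * (n : ℝ))) := by
          apply mul_le_mul hs2.le (by linarith) (by linarith) (by positivity)
      _ = 1 / N * (R ^ ((n : ℝ) + 1) * R ^ (-(1 + ui)) * R ^ (-(1 + ui) * (n : ℝ))) := by ring
      _ = _ := by
        rw [← Real.rpow_add hR0, ← Real.rpow_add hR0]
        congr 2; ring
  have h3 : 0 ≤ s * (x - a) := mul_nonneg hs0.le (by linarith)
  have e : 2 / N * R ^ (-((n : ℝ) + 1) * ui) = 1 / N * R ^ (-((n : ℝ) + 1) * ui)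
    + 1 / N * R ^ (-((n : ℝ) + 1) * ui) := by ring
  rw [e]
  rw [abs_le] at h1 ⊢
  constructor <;> nlinarith [h1.1, h1.2]

/-- Simplex lemma: the rational points `r/s` with `R^n ≤ s < R^(n+1)` that approximate some
point of a small box `E` to within `ε/s` in the `u`-weighted norm lie on an affine hyperplane. -/
theorem simplex_lemma (d : ℕ) (hd : 1 ≤ d) (R : ℝ) (hR : 1 < R) (n : ℕ)
    (u : Fin d → ℝ) (hu0 : ∀ i, 0 < u i) (hu1 : ∀ i, u i < 1) (humono : Monotone u)
    (husum : ∑ i, u i = 1)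
    (a b : Fin d → ℝ)
    (hab : ∀ i, b i - a i ≤
      (R ^ (-(1 + u i)) / (Nat.factorial (d + 1) : ℝ)) * R ^ (-(1 + u i) * (n : ℝ)))
    (ε : ℝ) (hε0 : 0 < ε)
    (hε1 : ε < R⁻¹ * ((Nat.factorial (d + 1) : ℝ)) ^ (-(1 / u ⟨0, by omega⟩))) :
    ∃ (v : Fin d → ℝ) (cst : ℝ), v ≠ 0 ∧
      ∀ (r : Fin d → ℤ) (s : ℕ), R ^ (n : ℝ) ≤ (s : ℝ) → (s : ℝ) < R ^ ((n : ℝ) + 1) →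
        (∃ x : Fin d → ℝ, (∀ i, x i ∈ Set.Icc (a i) (b i)) ∧
          wNorm u (fun i => (s : ℝ) * x i - (r i : ℝ)) ≤ ε / (s : ℝ)) →
        ∑ i, v i * ((r i : ℝ) / (s : ℝ)) = cst := by
  have hd2 : 2 ≤ d := by
    by_contra hlt
    obtain rfl : d = 1 := by omega
    have := hu1 0
    simp at husum
    linarith
  have hR0 : 0 < R := by linarith
  have hN1 : (1 : ℝ) ≤ (Nat.factorial (d + 1) : ℝ) := by
    exact_mod_cast Nat.factorial_pos (d + 1)
  let Q : (Fin d → ℤ) → ℕ → Prop := fun r s =>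
    R ^ (n : ℝ) ≤ (s : ℝ) ∧ (s : ℝ) < R ^ ((n : ℝ) + 1) ∧
        (∃ x : Fin d → ℝ, (∀ i, x i ∈ Set.Icc (a i) (b i)) ∧
          wNorm u (fun i => (s : ℝ) * x i - (r i : ℝ)) ≤ ε / (s : ℝ))
  let T : Set (Fin (d + 1) → ℝ) := {y | ∃ r s, Q r s ∧
    y = Fin.cons (s : ℝ) (fun i => (r i : ℝ))}
  have hQ : ∀ r s, Q r s → ∀ i, |(r i : ℝ) - s * a i| ≤
      2 / (Nat.factorial (d + 1) : ℝ) * R ^ (-((n : ℝ) + 1) * u i) := by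
    rintro r s ⟨h1, h2, x, hx, hw⟩ i
    refine coord_aux R hR n _ hN1 (u ⟨0, by omega⟩) (u i) (hu0 _) (humono (Nat.zero_le _)) ε hε0
      hε1 s h1 h2 (a i) (b i) (x i) (r i) (hab i) (hx i).1 (hx i).2 ?_
    exact (le_ciSup (f := fun i => |(s : ℝ) * x i - (r i : ℝ)| ^ (1 / u i))
      (Set.finite_range _).bddAbove i).trans hw
  obtain ⟨w, hw0, hw⟩ := functional_aux T (by
    intro f hf
    choose r s hq hfe using hf
    let M : Matrix (Fin (d + 1)) (Fin (d + 1)) ℤ :=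
      Matrix.of fun k => Fin.cons (s k : ℤ) (r k)
    let M' : Matrix (Fin (d + 1)) (Fin (d + 1)) ℝ :=
      Matrix.of fun k => Fin.cons (s k : ℝ) (fun i => (r k i : ℝ) - s k * a i)
    have e1 : (Matrix.of f).det = (M.det : ℝ) := by
      rw [Int.cast_det]
      congr 1
      ext k j
      refine Fin.cases ?_ (fun i => ?_) j <;> simp [M, hfe]
    have e2 : (Matrix.of f).det = M'.det := by
      rw [← Matrix.det_transpose, ← Matrix.det_transpose M']
      refine Matrix.det_eq_of_forall_row_eq_smul_add_const (Fin.cons 0 a) 0 (by simp) ?_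
      intro j k
      refine Fin.cases ?_ (fun i => ?_) j
      · simp [M', hfe]
      · simp [M', hfe]; ring
    have hb := det_bound_aux M' (Fin.cons (R ^ ((n : ℝ) + 1))
      (fun i => 2 / (Nat.factorial (d + 1) : ℝ) * R ^ (-((n : ℝ) + 1) * u i))) (by
      intro k j
      refine Fin.cases ?_ (fun i => ?_) j
      · simpa [M'] using (hq k).2.1.le
      · simpa [M'] using hQ _ _ (hq k) i)
    have hp : R ^ ((n : ℝ) + 1) * ∏ i, (2 / (Nat.factorial (d + 1) : ℝ) *
        R ^ (-((n : ℝ) + 1) * u i)) = (2 / (Nat.factorial (d + 1) : ℝ)) ^ d := by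
      rw [Finset.prod_mul_distrib, ← Real.rpow_sum_of_pos hR0, ← Finset.mul_sum, husum,
        mul_one, Real.rpow_neg hR0.le]
      have : R ^ ((n : ℝ) + 1) ≠ 0 := by positivity
      simp only [Finset.prod_const, Finset.card_univ, Fintype.card_fin]
      field_simp
    rw [Fin.prod_univ_succ] at hb
    simp only [Fin.cons_zero, Fin.cons_succ] at hb
    rw [hp, ← e2, e1] at hb
    have hlt := hb.trans_lt (const_aux d hd2)
    have : |M.det| < 1 := by exact_mod_cast hlt
    rw [Int.abs_lt_one_iff] at this
    rw [e1, this, Int.cast_zero])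
  by_cases hne : ∃ r s, Q r s
  · refine ⟨fun i => w i.succ, -w 0, ?_, ?_⟩
    · intro hv
      obtain ⟨r, s, hq⟩ := hne
      have hs0 : (0 : ℝ) < s := lt_of_lt_of_le (by positivity) hq.1
      have h0 := hw _ ⟨r, s, hq, rfl⟩
      have hv' : ∀ i, w (Fin.succ i) = 0 := fun i => congrFun hv i
      rw [Fin.sum_univ_succ] at h0
      simp only [hv', Fin.cons_zero, zero_mul, Finset.sum_const_zero, add_zero] at h0
      apply hw0
      ext j
      refine Fin.cases ?_ (fun i => ?_) j
      · simpa [hs0.ne'] using h0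
      · exact hv' i
    · intro r s h1 h2 h3
      have hs0 : (0 : ℝ) < s := lt_of_lt_of_le (by positivity) h1
      have h0 := hw _ ⟨r, s, ⟨h1, h2, h3⟩, rfl⟩
      rw [Fin.sum_univ_succ] at h0
      simp only [Fin.cons_zero, Fin.cons_succ] at h0
      simp only [← mul_div_assoc]
      rw [← Finset.sum_div, div_eq_iff hs0.ne']
      linarith
  · refine ⟨fun _ => 1, 0, ?_, ?_⟩
    · intro h
      have := congrFun h ⟨0, by omega⟩
      simp at this
    · intro r s h1 h2 h3
      exact absurd ⟨r, s, h1, h2, h3⟩ hne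
end

section
/- For every weight vector w ∈ (0,1)^d and every τ > 1 there exist an integer K with 0 ≤ K < d and a real number δ_0 = δ_0(w,τ) > 0 such that for every 0 < δ ≤ δ_0 there exists a vector w̃ ∈ (0,+∞)^d with the following properties: (τ1) w̃_i = τw_i − δ(1 + τw_i) for i = 1,…,K; (τ2) w̃_K ≤ w̃_{K+1} = … = w̃_d < τw_{K+1} − δ(1 + τw_{K+1}) (when K = 0 this reads w̃_1 = … = w̃_d < τw_1 − δ(1+τw_1) or w̃_i = 1/d as appropriate, with (τ1) vacuous); (τ3) Σ_{i=1}^d w̃_i = 1. In particular w̃_1 ≤ … ≤ w̃_d. -/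
open Real Set

lemma sum_ite_split (d : ℕ) (K : ℕ) : ∃ m : ℝ, 0 ≤ m ∧ (K < d → 0 < m) ∧ ∀ (f : Fin d → ℝ) (c : ℝ),
    ∑ i : Fin d, (if (i : ℕ) < K then f i else c)
      = (∑ i : Fin d, if (i : ℕ) < K then f i else 0) + m * c := by
  refine ⟨∑ i : Fin d, if (i : ℕ) < K then 0 else 1, ?_, ?_, ?_⟩
  · exact Finset.sum_nonneg (fun i _ => by split_ifs <;> norm_num)
  · intro hK
    refine Finset.sum_pos' (fun i _ => by split_ifs <;> norm_num) ⟨⟨K, hK⟩, Finset.mem_univ _, ?_⟩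
    simp
  · intro f c
    rw [Finset.sum_mul, ← Finset.sum_add_distrib]
    refine Finset.sum_congr rfl (fun i _ => ?_)
    split_ifs <;> simp

/-- Existence of the auxiliary weight vector `w̃` (Lemma on `τ`-adjusted weights).
Indices are 0-based: the mathematical `w_{i+1}` is `w i`, and the integer `K` counts how many
initial coordinates satisfy (τ1). -/
theorem aux_weight_exists (d : ℕ) (hd : 1 ≤ d) (w : Fin d → ℝ)
    (hw0 : ∀ i, 0 < w i) (hw1 : ∀ i, w i < 1) (hwmono : Monotone w)
    (hwsum : ∑ i, w i = 1) (τ : ℝ) (hτ : 1 < τ) :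
    ∃ (K : ℕ) (hK : K < d) (δ₀ : ℝ), 0 < δ₀ ∧
      ∀ δ : ℝ, 0 < δ → δ ≤ δ₀ →
        ∃ wt : Fin d → ℝ,
          (∀ i, 0 < wt i) ∧
          -- (τ1)
          (∀ i : Fin d, (i : ℕ) < K → wt i = τ * w i - δ * (1 + τ * w i)) ∧
          -- (τ2)
          (∀ i : Fin d, (i : ℕ) < K → wt i ≤ wt ⟨K, hK⟩) ∧
          (∀ i : Fin d, K ≤ (i : ℕ) → wt i = wt ⟨K, hK⟩) ∧
          wt ⟨K, hK⟩ < τ * w ⟨K, hK⟩ - δ * (1 + τ * w ⟨K, hK⟩) ∧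
          -- (τ3)
          (∑ i, wt i = 1) ∧
          -- in particular, wt is nondecreasing
          Monotone wt := by
  classical
  set a : Fin d → ℝ := fun i => τ * w i with ha
  have ha0 : ∀ i, 0 < a i := fun i => mul_pos (by linarith) (hw0 i)
  have hamono : Monotone a := fun i j h => mul_le_mul_of_nonneg_left (hwmono h) (by linarith)
  have hasum : ∑ i, a i = τ := by simp only [ha]; rw [← Finset.mul_sum, hwsum, mul_one]
  let F : Fin d → ℝ := fun k => ∑ i : Fin d, if (i : ℕ) < k then a i else a k
  have hex : ∃ k : ℕ, ∃ h : k < d, 1 < F ⟨k, h⟩ := by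
    refine ⟨d - 1, by omega, ?_⟩
    have : F ⟨d - 1, by omega⟩ = ∑ i, a i := by
      refine Finset.sum_congr rfl (fun i _ => ?_)
      split_ifs with h
      · rfl
      · congr 1
        ext
        simp only at h ⊢
        omega
    rw [this, hasum]; exact hτ
  obtain ⟨hK, hF⟩ := Nat.find_spec hex
  have hmin := fun k => Nat.find_min hex (m := k)
  generalize Nat.find hex = K at hK hF hmin
  set k : Fin d := ⟨K, hK⟩ with hk
  obtain ⟨m, -, hm, hsplit⟩ := sum_ite_split d K
  have hmpos := hm hK
  have hdpos : (0 : ℝ) < d := by exact_mod_cast hd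
  set z : Fin d := ⟨0, hd⟩ with hz
  have hFd : 0 < d + F k := by linarith
  have hza : 0 < 1 + a z := by linarith [ha0 z]
  refine ⟨K, hK, min ((F k - 1) / (2 * (d + F k))) (a z / (2 * (1 + a z))), ?_, ?_⟩
  · have := ha0 z
    have : 0 < F k - 1 := by linarith
    positivity
  intro δ hδ hδ0
  have h1 := hδ0.trans (min_le_left _ _)
  have h2 := hδ0.trans (min_le_right _ _)
  rw [le_div_iff₀ (by positivity)] at h1 h2
  have hδ1 : δ < 1 := by nlinarith [ha0 z]
  set v : Fin d → ℝ := fun i => a i - δ * (1 + a i) with hv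
  have hvmono : Monotone v := fun i j h => by
    have := hamono h
    simp only [hv]; nlinarith
  have hvpos : ∀ i, 0 < v i := fun i => by
    have h : v z ≤ v i := hvmono (Fin.mk_le_of_le_val (Nat.zero_le _))
    have : 0 < v z := by simp only [hv]; nlinarith [ha0 z]
    linarith
  have hvs : ∀ j : Fin d, (∑ i : Fin d, if (i : ℕ) < j then v i else v j)
      = F j - δ * (d + F j) := by
    intro j
    have hd' : (d : ℝ) = ∑ i : Fin d, (1 : ℝ) := by simp
    simp only [F]
    rw [hd', ← Finset.sum_add_distrib, Finset.mul_sum, ← Finset.sum_sub_distrib]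
    refine Finset.sum_congr rfl (fun i _ => ?_)
    split_ifs <;> rfl
  set S : ℝ := ∑ i : Fin d, if (i : ℕ) < K then v i else 0 with hS
  set c : ℝ := (1 - S) / m with hc
  have hmc : S + m * c = 1 := by rw [hc]; field_simp; ring
  have hcv : c < v k := by
    have e1 : S + m * v k = F k - δ * (d + F k) := (hsplit v (v k)).symm.trans (hvs k)
    have : m * c < m * v k := by nlinarith
    exact lt_of_mul_lt_mul_left this hmpos.le
  have hlow : ∀ i : Fin d, (i : ℕ) < K → v i ≤ c := by
    intro i hi
    have hK1 : K - 1 < d := by omega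
    have hle : v i ≤ v ⟨K - 1, hK1⟩ := hvmono (by rw [Fin.le_def]; simp only; omega)
    refine hle.trans ?_
    have hF1 : F ⟨K - 1, hK1⟩ ≤ 1 := by
      by_contra hcon
      exact hmin (K - 1) (by omega) ⟨hK1, not_le.mp hcon⟩
    have e2 : S + m * v ⟨K - 1, hK1⟩
        = F ⟨K - 1, hK1⟩ - δ * (d + F ⟨K - 1, hK1⟩) := by
      rw [← hvs, ← hsplit v]
      refine Finset.sum_congr rfl (fun j _ => ?_)
      simp only
      by_cases hj : (j : ℕ) < K - 1
      · rw [if_pos hj, if_pos (by omega)]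
      · rw [if_neg hj]
        split_ifs with hj2
        · congr 1
          ext
          simp only
          omega
        · rfl
    have hF0 : 0 ≤ F ⟨K - 1, hK1⟩ := Finset.sum_nonneg (fun j _ => by
      split_ifs
      · exact (ha0 _).le
      · exact (ha0 _).le)
    have : m * v ⟨K - 1, hK1⟩ ≤ m * c := by
      have : 0 ≤ δ * (d + F ⟨K - 1, hK1⟩) := by positivity
      linarith
    exact le_of_mul_le_mul_left this hmpos
  have hcpos : 0 < c := by
    rcases Nat.eq_zero_or_pos K with h0 | h0
    · have : S = 0 := by simp [hS, h0]
      rw [hc, this]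
      have : (0 : ℝ) < 1 - 0 := by norm_num
      positivity
    · exact (hvpos z).trans_le (hlow z h0)
  have hwk : (if ((k : Fin d) : ℕ) < K then v k else c) = c := if_neg (lt_irrefl _)
  refine ⟨fun i => if (i : ℕ) < K then v i else c, ?_, ?_, ?_, ?_, ?_, ?_, ?_⟩
  · intro i
    simp only
    split_ifs
    · exact hvpos i
    · exact hcpos
  · intro i hi
    simp only
    rw [if_pos hi]
  · intro i hi
    simp only [hwk]
    rw [if_pos hi]
    simpa using hlow i hi
  · intro i hi
    simp [not_lt.mpr hi, hk]
  · simpa [hk] using hcv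
  · exact (hsplit v c).trans hmc
  · intro i j hij
    have : (i : ℕ) ≤ j := hij
    simp only
    split_ifs with h3 h4
    · exact hvmono hij
    · exact hlow i h3
    · omega
    · exact le_rfl
end

section
/- Let w ∈ (0,1)^d be a weight vector, τ > 1, δ > 0, 0 ≤ K < d, and let w̃ ∈ (0,+∞)^d satisfy: w̃_i = τw_i − δ(1+τw_i) for i = 1,…,K; w̃_K ≤ w̃_{K+1} = … = w̃_d < τw_{K+1} − δ(1+τw_{K+1}); Σ_{i=1}^d w̃_i = 1; and w̃_1 > 0. Then 0 < w̃_1 ≤ w̃_2 ≤ … ≤ w̃_d, and 1 < (1+τw_1)/(1+w̃_1) = … = (1+τw_K)/(1+w̃_K) < (1+τw_{K+1})/(1+w̃_{K+1}) ≤ … ≤ (1+τw_d)/(1+w̃_d), where the common value of the first K ratios is 1/(1−δ). -/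
open Real Set

/-- Basic properties of the auxiliary weight vector `w̃` (0-indexed: `w i` is the
mathematical `w_{i+1}`). -/
theorem aux_weight_ratios (d : ℕ) (hd : 1 ≤ d) (w : Fin d → ℝ)
    (hw0 : ∀ i, 0 < w i) (hw1 : ∀ i, w i < 1) (hwmono : Monotone w)
    (hwsum : ∑ i, w i = 1) (τ : ℝ) (hτ : 1 < τ) (δ : ℝ) (hδ : 0 < δ)
    (K : ℕ) (hK : K < d) (wt : Fin d → ℝ)
    -- (τ1)
    (ht1 : ∀ i : Fin d, (i : ℕ) < K → wt i = τ * w i - δ * (1 + τ * w i))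
    -- (τ2)
    (ht2a : ∀ i : Fin d, (i : ℕ) + 1 = K → wt i ≤ wt ⟨K, hK⟩)
    (ht2b : ∀ i : Fin d, K ≤ (i : ℕ) → wt i = wt ⟨K, hK⟩)
    (ht2c : wt ⟨K, hK⟩ < τ * w ⟨K, hK⟩ - δ * (1 + τ * w ⟨K, hK⟩))
    -- (τ3)
    (ht3 : ∑ i, wt i = 1)
    -- w̃₁ > 0
    (htpos : 0 < wt ⟨0, by omega⟩) :
    (∀ i, 0 < wt i) ∧ Monotone wt ∧
      (∀ i : Fin d, 1 < (1 + τ * w i) / (1 + wt i)) ∧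
      (∀ i : Fin d, (i : ℕ) < K → (1 + τ * w i) / (1 + wt i) = 1 / (1 - δ)) ∧
      (∀ i j : Fin d, i ≤ j → (1 + τ * w i) / (1 + wt i) ≤ (1 + τ * w j) / (1 + wt j)) ∧
      (∀ i : Fin d, (i : ℕ) < K →
        (1 + τ * w i) / (1 + wt i) < (1 + τ * w ⟨K, hK⟩) / (1 + wt ⟨K, hK⟩)) := by
  have hτw : ∀ i, 0 < τ * w i := fun i => mul_pos (by linarith) (hw0 i)
  have hτm : ∀ i j, i ≤ j → τ * w i ≤ τ * w j := fun i j h =>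
    mul_le_mul_of_nonneg_left (hwmono h) (by linarith)
  have hδ1 : δ < 1 := by
    have key : ∃ i, 0 < τ * w i - δ * (1 + τ * w i) := by
      rcases Nat.eq_zero_or_pos K with h | h
      · subst h
        exact ⟨_, htpos.trans ht2c⟩
      · have h1 := ht1 ⟨0, by omega⟩ h
        exact ⟨⟨0, by omega⟩, by rw [← h1]; exact htpos⟩
    obtain ⟨i, hi⟩ := key
    by_contra hc
    have h2 := hτw i
    nlinarith [mul_nonneg (sub_nonneg.2 (not_lt.1 hc)) h2.le]
  have hmono : Monotone wt := by
    have small : ∀ i j : Fin d, i ≤ j → (j : ℕ) < K → wt i ≤ wt j := by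
      intro i j hij hj
      have hi : (i : ℕ) < K := lt_of_le_of_lt hij hj
      rw [ht1 i hi, ht1 j hj]
      nlinarith [mul_nonneg (sub_nonneg.2 hδ1.le) (sub_nonneg.2 (hτm i j hij))]
    intro i j hij
    rcases lt_or_ge (j : ℕ) K with hj | hj
    · exact small i j hij hj
    · rw [ht2b j hj]
      rcases lt_or_ge (i : ℕ) K with hi | hi
      · refine (small i ⟨K - 1, by omega⟩ ?_ ?_).trans (ht2a ⟨K - 1, by omega⟩ ?_)
        · rw [Fin.le_def]
          show (i : ℕ) ≤ K - 1
          omega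
        · show K - 1 < K
          omega
        · show K - 1 + 1 = K
          omega
      · rw [ht2b i hi]
  have hpos : ∀ i, 0 < wt i := fun i => htpos.trans_le (hmono (by
    rw [Fin.le_def]; exact Nat.zero_le _))
  have hp1 : ∀ i, 0 < 1 + wt i := fun i => by linarith [hpos i]
  have hd1 : 0 < 1 - δ := by linarith
  have heq : ∀ i : Fin d, (i : ℕ) < K → (1 + τ * w i) / (1 + wt i) = 1 / (1 - δ) := by
    intro i hi
    rw [div_eq_div_iff (hp1 i).ne' hd1.ne', ht1 i hi]
    ring
  have hlt : ∀ i : Fin d, K ≤ (i : ℕ) → 1 / (1 - δ) < (1 + τ * w i) / (1 + wt i) := by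
    intro i hi
    rw [div_lt_div_iff₀ hd1 (hp1 i), ht2b i hi]
    have h := hτm ⟨K, hK⟩ i hi
    nlinarith [mul_nonneg hd1.le (sub_nonneg.2 h)]
  have h1 : 1 < 1 / (1 - δ) := by
    rw [lt_div_iff₀ hd1]
    linarith
  refine ⟨hpos, hmono, ?_, heq, ?_, ?_⟩
  · intro i
    rcases lt_or_ge (i : ℕ) K with hi | hi
    · rw [heq i hi]
      exact h1
    · exact h1.trans (hlt i hi)
  · intro i j hij
    rcases lt_or_ge (i : ℕ) K with hi | hi
    · rw [heq i hi]
      rcases lt_or_ge (j : ℕ) K with hj | hj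
      · rw [heq j hj]
      · exact (hlt j hj).le
    · have hj : K ≤ (j : ℕ) := hi.trans hij
      rw [ht2b i hi, ht2b j hj]
      exact div_le_div_of_nonneg_right (by linarith [hτm i j hij]) (hp1 _).le
  · intro i hi
    rw [heq i hi]
    exact hlt _ le_rfl
end

section
/- Let d ≥ 2, let w ∈ (0,1)^d be a weight vector, τ > 1, 0 < δ < min{δ_0, τw_1/(1+τw_1)}, and let w̃ be the auxiliary weight vector associated to (w,τ,δ) (satisfying (τ1)–(τ3)). Let R > (8(d+1)!)^{1/(1+w̃_1)}. Set α := max_{1≤i≤d} τw_i/w̃_i, and α' := min{w_j − w_1 : 1 ≤ j ≤ d, w_j ≠ w_1} if some w_j ≠ w_1, else α' := 1. Let ε ∈ (0, R^{−2(1+1/w̃_1)}((d+1)!)^{−1/w̃_1}], let c ∈ (3/4, 1) with 1 − c > ε, and let n_k ∈ ℕ satisfy n_k ≥ −max{ (2(1+τw_1)/(1+w̃_1) + d + 1)/(α'(τw_1 − w̃_1)(1 − 1/(1+w̃_1))), 4, 2/(τ−1) } · log_R ε. For i = 1,…,d define n_k^{(i)} := ⌊((1+τw_i)/(1+w̃_i))(n_k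 − 2 log_R ε)⌋ + 1 and ρ_0^{(i)} := R^{−(1+w̃_i)}/(d+1)!. Then: (a) n_k ≤ n_k^{(1)} ≤ n_k^{(2)} ≤ … ≤ n_k^{(d)}; (b) R^{n_k^{(1)}} ≤ R^{(1+τw_1−w̃_1)n_k} ε^d; (c) R^{−(1+w̃_i)n_k^{(i)}} ≤ (1−c) ε^{1+τw_i} R^{−n_k(1+τw_i)} for every i = 1,…,d; (d) n_k^{(d)} ≤ 2(1+τw_d)/(1+w̃_d) · n_k; (e) for every integer n ≥ n_k^{(1)}, max_{1≤i≤d} R^{−(1+τw_i)n} / (ρ_0^{(i)} R^{−(1+w̃_i)·max{n, n_k^{(i)}}}) = R^{−(1+τw_1)n} / (ρ_0^{(1)} R^{−(1+w̃_1)·max{n, n_k^{(1)}}}). -/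
open Real Set

/-- `n_k^{(i)} = ⌊((1+τw_i)/(1+w̃_i))(n_k − 2 log_R ε)⌋ + 1`. -/
noncomputable def nkIdx {d : ℕ} (w wt : Fin d → ℝ) (τ R ε : ℝ) (nk : ℕ) (i : Fin d) : ℤ :=
  ⌊(1 + τ * w i) / (1 + wt i) * ((nk : ℝ) - 2 * Real.logb R ε)⌋ + 1

set_option maxHeartbeats 2000000

/-- Technical estimates on the indices `n_k^{(i)}` of the Cantor-set construction. -/
theorem nk_indices_estimates (d : ℕ) (hd : 2 ≤ d) (w : Fin d → ℝ)
    (hw0 : ∀ i, 0 < w i) (hw1 : ∀ i, w i < 1) (hwmono : Monotone w)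
    (hwsum : ∑ i, w i = 1) (τ : ℝ) (hτ : 1 < τ)
    (δ : ℝ) (hδ : 0 < δ)
    (hδ' : δ < τ * w ⟨0, by omega⟩ / (1 + τ * w ⟨0, by omega⟩))
    (K : ℕ) (hK : K < d) (wt : Fin d → ℝ) (htpos : ∀ i, 0 < wt i)
    -- (τ1)–(τ3) for the auxiliary weight vector wt = w̃
    (ht1 : ∀ i : Fin d, (i : ℕ) < K → wt i = τ * w i - δ * (1 + τ * w i))
    (ht2a : ∀ i : Fin d, (i : ℕ) < K → wt i ≤ wt ⟨K, hK⟩)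
    (ht2b : ∀ i : Fin d, K ≤ (i : ℕ) → wt i = wt ⟨K, hK⟩)
    (ht2c : wt ⟨K, hK⟩ < τ * w ⟨K, hK⟩ - δ * (1 + τ * w ⟨K, hK⟩))
    (ht3 : ∑ i, wt i = 1)
    (R : ℝ)
    (hR : (8 * (Nat.factorial (d + 1) : ℝ)) ^ ((1 : ℝ) / (1 + wt ⟨0, by omega⟩)) < R)
    (α' : ℝ)
    (hα'1 : (∃ j : Fin d, w j ≠ w ⟨0, by omega⟩) →
      IsLeast {t : ℝ | ∃ j : Fin d, w j ≠ w ⟨0, by omega⟩ ∧ t = w j - w ⟨0, by omega⟩} α')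
    (hα'2 : (∀ j : Fin d, w j = w ⟨0, by omega⟩) → α' = 1)
    (ε : ℝ) (hε0 : 0 < ε)
    (hε1 : ε ≤ R ^ (-(2 * (1 + 1 / wt ⟨0, by omega⟩))) *
      ((Nat.factorial (d + 1) : ℝ)) ^ (-(1 / wt ⟨0, by omega⟩)))
    (c : ℝ) (hc1 : 3 / 4 < c) (hc2 : c < 1) (hcε : ε < 1 - c)
    (nk : ℕ)
    (hnk : -(max (max ((2 * (1 + τ * w ⟨0, by omega⟩) / (1 + wt ⟨0, by omega⟩) + d + 1) /
        (α' * (τ * w ⟨0, by omega⟩ - wt ⟨0, by omega⟩) * (1 - 1 / (1 + wt ⟨0, by omega⟩)))) 4)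
        (2 / (τ - 1))) * Real.logb R ε ≤ (nk : ℝ)) :
    -- (a)
    ((nk : ℤ) ≤ nkIdx w wt τ R ε nk ⟨0, by omega⟩ ∧
      ∀ i j : Fin d, i ≤ j → nkIdx w wt τ R ε nk i ≤ nkIdx w wt τ R ε nk j) ∧
    -- (b)
    (R ^ ((nkIdx w wt τ R ε nk ⟨0, by omega⟩ : ℝ)) ≤
      R ^ ((1 + τ * w ⟨0, by omega⟩ - wt ⟨0, by omega⟩) * (nk : ℝ)) * ε ^ d) ∧
    -- (c)
    (∀ i : Fin d, R ^ (-(1 + wt i) * ((nkIdx w wt τ R ε nk i : ℤ) : ℝ)) ≤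
      (1 - c) * ε ^ (1 + τ * w i) * R ^ (-(nk : ℝ) * (1 + τ * w i))) ∧
    -- (d)
    (((nkIdx w wt τ R ε nk ⟨d - 1, by omega⟩ : ℤ) : ℝ) ≤
      2 * ((1 + τ * w ⟨d - 1, by omega⟩) / (1 + wt ⟨d - 1, by omega⟩)) * (nk : ℝ)) ∧
    -- (e)
    (∀ n : ℤ, nkIdx w wt τ R ε nk ⟨0, by omega⟩ ≤ n → ∀ i : Fin d,
      R ^ (-(1 + τ * w i) * (n : ℝ)) /
        ((R ^ (-(1 + wt i)) / (Nat.factorial (d + 1) : ℝ)) *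
          R ^ (-(1 + wt i) * ((max n (nkIdx w wt τ R ε nk i) : ℤ) : ℝ))) ≤
      R ^ (-(1 + τ * w ⟨0, by omega⟩) * (n : ℝ)) /
        ((R ^ (-(1 + wt ⟨0, by omega⟩)) / (Nat.factorial (d + 1) : ℝ)) *
          R ^ (-(1 + wt ⟨0, by omega⟩) *
            ((max n (nkIdx w wt τ R ε nk ⟨0, by omega⟩) : ℤ) : ℝ)))) := by
  obtain ⟨z, hz⟩ : ∃ z : Fin d, z = ⟨0, by omega⟩ := ⟨_, rfl⟩
  simp only [← hz] at hδ' hR hα'1 hα'2 hε1 hnk ⊢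
  have hzle : ∀ i : Fin d, z ≤ i := by
    intro i; rw [hz, Fin.le_def]; exact Nat.zero_le _
  obtain ⟨F, hF⟩ : ∃ F : ℝ, F = (Nat.factorial (d + 1) : ℝ) := ⟨_, rfl⟩
  simp only [← hF] at hR hε1 ⊢
  have hF1 : 1 ≤ F := by
    rw [hF]; exact_mod_cast Nat.one_le_iff_ne_zero.mpr (Nat.factorial_ne_zero _)
  have hd' : (2 : ℝ) ≤ d := by exact_mod_cast hd
  have hR1 : 1 < R := by
    refine lt_of_le_of_lt ?_ hR
    apply Real.one_le_rpow (by linarith)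
    have := htpos z
    positivity
  have hR0 : 0 < R := by linarith
  -- elementary facts on the weights
  have ha1 : ∀ i, 1 < 1 + τ * w i := fun i => by have := hw0 i; nlinarith
  have hb1 : ∀ i, 1 < 1 + wt i := fun i => by linarith [htpos i]
  have hδ1 : δ < 1 := by
    refine lt_trans hδ' ?_
    rw [div_lt_one (by linarith [ha1 z])]; linarith
  have hble : ∀ i, 1 + wt i ≤ (1 - δ) * (1 + τ * w i) := by
    intro i
    rcases lt_or_ge (i : ℕ) K with h | h
    · rw [ht1 i h]; linarith
    · rw [ht2b i h]
      have : w ⟨K, hK⟩ ≤ w i := hwmono (by rw [Fin.le_def]; exact h)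
      have h2 : 0 ≤ τ * (1 - δ) * (w i - w ⟨K, hK⟩) := by
        apply mul_nonneg (mul_nonneg _ _) <;> linarith
      linarith
  have hbeq : ∀ i : Fin d, (i : ℕ) < K → 1 + wt i = (1 - δ) * (1 + τ * w i) := by
    intro i h; rw [ht1 i h]; ring
  have hbmono : ∀ i j : Fin d, i ≤ j → wt i ≤ wt j := by
    intro i j hij
    have hij' : (i : ℕ) ≤ j := hij
    rcases lt_or_ge (i : ℕ) K with h | h
    · rcases lt_or_ge (j : ℕ) K with h' | h'
      · have h1 := hbeq i h
        have h2 := hbeq j h'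
        have h3 : 0 ≤ τ * (1 - δ) * (w j - w i) := by
          have := hwmono hij
          apply mul_nonneg (mul_nonneg _ _) <;> linarith
        linarith
      · rw [ht2b j h']; exact ht2a i h
    · rw [ht2b i h, ht2b j (by omega)]
  have hamono : ∀ i j : Fin d, i ≤ j → 1 + τ * w i ≤ 1 + τ * w j := by
    intro i j hij
    have := hwmono hij
    nlinarith
  have hrge : ∀ i, 1 ≤ (1 + τ * w i) / (1 + wt i) := by
    intro i
    rw [le_div_iff₀ (by linarith [hb1 i])]
    have := hble i
    nlinarith [ha1 i]
  have hrmono : ∀ i j : Fin d, i ≤ j →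
      (1 + τ * w i) / (1 + wt i) ≤ (1 + τ * w j) / (1 + wt j) := by
    intro i j hij
    have hij' : (i : ℕ) ≤ j := hij
    rw [div_le_div_iff₀ (by linarith [hb1 i]) (by linarith [hb1 j])]
    rcases lt_or_ge (i : ℕ) K with h | h
    · rw [hbeq i h]
      have := mul_le_mul_of_nonneg_left (hble j) (by linarith [ha1 i] : 0 ≤ 1 + τ * w i)
      linarith
    · rw [ht2b i h, ht2b j (by omega)]
      exact mul_le_mul_of_nonneg_right (hamono i j hij) (by linarith [hb1 ⟨K, hK⟩])
  have hbweq : ∀ i, w i = w z → wt i = wt z := by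
    intro i hi
    have hzv : (z : ℕ) = 0 := by rw [hz]
    have hzi := hbmono z i (hzle i)
    apply le_antisymm _ hzi
    rcases lt_or_ge (z : ℕ) K with h | h
    · have := hble i
      rw [hi, ← hbeq z h] at this
      linarith
    · rw [ht2b z h, ht2b i (by omega)]
  have hwtz1 : wt z < 1 := by
    obtain ⟨o, ho⟩ : ∃ o : Fin d, o ≠ z := ⟨⟨1, by omega⟩, by
      rw [hz]; intro h; simp [Fin.ext_iff] at h⟩
    have := Finset.add_le_sum (f := wt) (fun i _ => (htpos i).le) (Finset.mem_univ z)
      (Finset.mem_univ o) (Ne.symm ho)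
    linarith [htpos o]
  have hwt1 : ∀ i, wt i ≤ 1 := by
    intro i
    rw [← ht3]
    exact Finset.single_le_sum (fun i _ => (htpos i).le) (Finset.mem_univ i)
  -- bounds for the minimal gap
  have hα : 0 < α' ∧ α' ≤ 1 ∧ ∀ i, w i ≠ w z → α' ≤ w i - w z := by
    by_cases h : ∃ j, w j ≠ w z
    · obtain ⟨⟨j, hj, hj'⟩, hlb⟩ := hα'1 h
      have h1 := hwmono (hzle j)
      have h2 : w z < w j := lt_of_le_of_ne h1 (Ne.symm hj)
      refine ⟨by linarith, by linarith [hw1 j, hw0 z], ?_⟩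
      intro i hi
      exact hlb ⟨i, hi, rfl⟩
    · push Not at h
      rw [hα'2 h]
      exact ⟨one_pos, le_rfl, fun i hi => absurd (h i) hi⟩
  obtain ⟨hα0, hα1, hαw⟩ := hα
  -- ε
  obtain ⟨L, hL⟩ : ∃ L : ℝ, L = - Real.logb R ε := ⟨_, rfl⟩
  have hεR : ε = R ^ (-L) := by
    rw [hL, neg_neg, Real.rpow_logb hR0 hR1.ne' hε0]
  have hlog : Real.logb R ε = -L := by rw [hL]; ring
  have hL2 : 2 ≤ L := by
    have h1 : ε ≤ R ^ (-(2:ℝ)) := by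
      refine hε1.trans ?_
      have h0 : 0 < 1 / wt z := by have := htpos z; positivity
      have h2 : F ^ (-(1 / wt z)) ≤ 1 := Real.rpow_le_one_of_one_le_of_nonpos hF1 (by linarith)
      have h3 : R ^ (-(2 * (1 + 1 / wt z))) ≤ R ^ (-(2:ℝ)) :=
        Real.rpow_le_rpow_of_exponent_le hR1.le (by linarith)
      have h4 : 0 < R ^ (-(2 * (1 + 1 / wt z))) := Real.rpow_pos_of_pos hR0 _
      nlinarith
    rw [hεR, Real.rpow_le_rpow_left_iff hR1] at h1
    linarith
  have hN : ∀ i, nkIdx w wt τ R ε nk i =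
      ⌊(1 + τ * w i) / (1 + wt i) * ((nk : ℝ) + 2 * L)⌋ + 1 := by
    intro i; unfold nkIdx; rw [hlog]; congr 3; ring
  obtain ⟨N, hNdef⟩ : ∃ N : Fin d → ℤ, N = nkIdx w wt τ R ε nk := ⟨_, rfl⟩
  simp only [← hNdef] at hN ⊢
  have hNlo : ∀ i, (1 + τ * w i) / (1 + wt i) * ((nk : ℝ) + 2 * L) < (N i : ℝ) := by
    intro i; rw [hN i]; push_cast; exact Int.lt_floor_add_one _
  have hNhi : ∀ i, (N i : ℝ) ≤ (1 + τ * w i) / (1 + wt i) * ((nk : ℝ) + 2 * L) + 1 := by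
    intro i; rw [hN i]; push_cast; linarith [Int.floor_le ((1 + τ * w i) / (1 + wt i) * ((nk : ℝ) + 2 * L))]
  have hnk0 : (0 : ℝ) ≤ nk := Nat.cast_nonneg _
  -- consequences of the lower bound on nk
  rw [hlog] at hnk
  have hnk4 : 4 * L ≤ nk := by
    refine le_trans ?_ hnk
    rw [neg_mul_neg]
    exact mul_le_mul_of_nonneg_right ((le_max_right _ _).trans (le_max_left _ _)) (by linarith)
  have hbz := hb1 z
  have haz := ha1 z
  have hbne : 1 + wt z ≠ 0 := by linarith
  have hgap : 0 < τ * w z - wt z := by have := hble z; nlinarith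
  have hq : 1 - 1 / (1 + wt z) = wt z / (1 + wt z) := by field_simp; ring
  have hwz := htpos z
  have hq0 : 0 < wt z / (1 + wt z) := by positivity
  have hbig : (2 * ((1 + τ * w z) / (1 + wt z)) + d + 1) * L ≤
      α' * ((τ * w z - wt z) * (wt z / (1 + wt z)) * nk) := by
    have h1 : (2 * (1 + τ * w z) / (1 + wt z) + d + 1) /
        (α' * (τ * w z - wt z) * (wt z / (1 + wt z))) * L ≤ nk := by
      refine le_trans ?_ hnk
      rw [neg_mul_neg, hq]
      exact mul_le_mul_of_nonneg_right ((le_max_left _ _).trans (le_max_left _ _)) (by linarith)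
    rw [div_mul_eq_mul_div, div_le_iff₀ (by positivity)] at h1
    rw [mul_div_assoc] at h1
    linarith
  have hbig1 : (2 * ((1 + τ * w z) / (1 + wt z)) + d + 1) * L ≤
      (τ * w z - wt z) * (wt z / (1 + wt z)) * nk := by
    refine hbig.trans ?_
    exact mul_le_of_le_one_left (by positivity) hα1
  obtain ⟨r, hr⟩ : ∃ r : ℝ, r = (1 + τ * w z) / (1 + wt z) := ⟨_, rfl⟩
  have hr1 := hrge z
  have hNlz := hNlo z
  have hNhz := hNhi z
  rw [← hr] at hr1 hbig hbig1 hNlz hNhz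
  have hrb : r * (1 + wt z) = 1 + τ * w z := by rw [hr]; field_simp
  obtain ⟨q, hqd⟩ : ∃ q : ℝ, q = wt z / (1 + wt z) := ⟨_, rfl⟩
  rw [← hqd] at hbig hbig1 hq0
  have hqb : q * (1 + wt z) = wt z := by rw [hqd]; field_simp
  have hmon : ∀ i j : Fin d, i ≤ j → N i ≤ N j := by
    intro i j hij
    rw [hN i, hN j]
    gcongr ?_ + 1
    apply Int.floor_le_floor
    exact mul_le_mul_of_nonneg_right (hrmono i j hij) (by linarith)
  refine ⟨⟨?_, hmon⟩, ?_, ?_, ?_, ?_⟩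
  · have : (nk : ℝ) ≤ (N z : ℝ) := by nlinarith
    exact_mod_cast this
  · rw [hεR, ← Real.rpow_natCast, ← Real.rpow_mul hR0.le, ← Real.rpow_add hR0,
      Real.rpow_le_rpow_left_iff hR1]
    have key : (1 + τ * w z - wt z) - r = (τ * w z - wt z) * q := by
      rw [hr, hqd]; field_simp; ring
    have : (1 + τ * w z - wt z) * nk = r * nk + (τ * w z - wt z) * q * nk := by
      rw [← key]; ring
    linarith
  · intro i
    have h1 : ε ^ (1 + τ * w i) ≤ 1 - c := by
      have : ε ^ (1 + τ * w i) ≤ ε ^ (1:ℝ) :=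
        Real.rpow_le_rpow_of_exponent_ge hε0 (by linarith) (ha1 i).le
      rw [Real.rpow_one] at this
      linarith
    have h2 : R ^ (-(1 + wt i) * (N i : ℝ)) ≤
        ε ^ (1 + τ * w i) * ε ^ (1 + τ * w i) * R ^ (-(nk : ℝ) * (1 + τ * w i)) := by
      rw [hεR, ← Real.rpow_mul hR0.le, ← Real.rpow_add hR0, ← Real.rpow_add hR0,
        Real.rpow_le_rpow_left_iff hR1]
      have h3 := (hNlo i).le
      rw [div_mul_eq_mul_div, div_le_iff₀ (by linarith [hb1 i])] at h3
      linarith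
    refine h2.trans ?_
    have h4 : 0 < ε ^ (1 + τ * w i) := Real.rpow_pos_of_pos hε0 _
    have h5 : 0 < R ^ (-(nk : ℝ) * (1 + τ * w i)) := Real.rpow_pos_of_pos hR0 _
    gcongr
  · have h1 := hNhi ⟨d - 1, by omega⟩
    have h2 := hrge ⟨d - 1, by omega⟩
    nlinarith
  · intro n hn i
    have hconv : ∀ x y t : ℝ, R ^ x / (R ^ y / F * R ^ t) = F * R ^ (x - y - t) := by
      intro x y t
      rw [Real.rpow_sub hR0, Real.rpow_sub hR0]
      have := Real.rpow_pos_of_pos hR0 y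
      have := Real.rpow_pos_of_pos hR0 t
      field_simp
    rw [hconv, hconv, max_eq_left hn]
    apply mul_le_mul_of_nonneg_left _ (by linarith)
    rw [Real.rpow_le_rpow_left_iff hR1]
    by_cases hi : w i = w z
    · have hNi : N i = N z := by rw [hN i, hN z, hi, hbweq i hi]
      rw [hNi, max_eq_left hn, hi, hbweq i hi]
    have hwi := hαw i hi
    have hnR : (N z : ℝ) ≤ n := by exact_mod_cast hn
    have hbi := hbmono z i (hzle i)
    have haa := hamono z i (hzle i)
    have hnkn : (nk : ℝ) ≤ n := by nlinarith
    rcases le_total (N i) n with h | h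
    · rw [max_eq_left h]
      have hgoal : wt i - wt z ≤ ((τ * w i - wt i) - (τ * w z - wt z)) * n := by
        rcases lt_or_ge (z : ℕ) K with hzK | hzK
        · have e1 := hbeq z hzK
          have e2 := hble i
          have e3 : 1 - δ ≤ δ * n := by
            have e4 : τ * w z - wt z = δ * (1 + τ * w z) := by linarith
            have e5 : (τ * w z - wt z) * q = δ * r * wt z := by
              rw [e4]
              linear_combination (-δ * q) * hrb + δ * r * hqb
            rw [e5] at hbig1
            have e6 : δ * r * wt z * nk ≤ δ * r * nk := by
              have : δ * r * nk * wt z ≤ δ * r * nk :=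
                mul_le_of_le_one_right (by positivity) hwtz1.le
              linarith
            have e7 : 2 * L * r ≤ δ * nk * r := by nlinarith
            have e8 : 2 * L ≤ δ * nk := le_of_mul_le_mul_right e7 (by linarith)
            have e9 : δ * nk ≤ δ * n := mul_le_mul_of_nonneg_left hnkn hδ.le
            linarith
          have e6 : δ * (τ * w i - τ * w z) ≤ (τ * w i - wt i) - (τ * w z - wt z) := by linarith
          have e7 : wt i - wt z ≤ (1 - δ) * (τ * w i - τ * w z) := by linarith
          have e8 : 0 ≤ τ * w i - τ * w z := by linarith
          have e9 := mul_le_mul_of_nonneg_right e6 (by linarith : (0:ℝ) ≤ n)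
          have e10 := mul_le_mul_of_nonneg_right e3 e8
          linarith
        · rw [ht2b z hzK, ht2b i (le_trans hzK (hzle i))]
          have : 0 ≤ (τ * w i - τ * w z) * n := mul_nonneg (by linarith) (by linarith)
          linarith
      linarith
    · rw [max_eq_right h]
      have h3 := hNhi i
      have h4 := mul_le_mul_of_nonneg_left h3 (by linarith [hb1 i] : 0 ≤ 1 + wt i)
      have h5 : (1 + wt i) * ((1 + τ * w i) / (1 + wt i) * ((nk : ℝ) + 2 * L) + 1) =
          (1 + τ * w i) * (nk + 2 * L) + (1 + wt i) := by
        have := hb1 i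
        have : 1 + wt i ≠ 0 := by linarith
        field_simp
      rw [h5] at h4
      -- lower bound for the main term
      have h6 : (r - 1) * (1 + wt z) = τ * w z - wt z := by linarith
      have h7 : 4 ≤ (τ * w i - τ * w z) * (r - 1) * (nk + 2 * L) := by
        have s1 : α' * (r - 1) * nk ≤ (τ * w i - τ * w z) * (r - 1) * (nk + 2 * L) := by
          have : α' ≤ τ * w i - τ * w z := by nlinarith
          have : 0 ≤ r - 1 := by linarith
          have : (nk : ℝ) ≤ nk + 2 * L := by linarith
          gcongr
          exact mul_nonneg (by linarith) (by linarith)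
        have s2 : α' * ((τ * w z - wt z) * q * nk) = α' * (r - 1) * nk * wt z := by
          rw [← h6]
          linear_combination α' * (r - 1) * nk * hqb
        have s3 : α' * (r - 1) * nk * wt z ≤ α' * (r - 1) * nk := by
          apply mul_le_of_le_one_right _ hwtz1.le
          have : 0 ≤ r - 1 := by linarith
          positivity
        have s4 : 4 ≤ (2 * r + d + 1) * L := by nlinarith
        linarith
      have h8 : (τ * w i - τ * w z + (1 + wt z)) * (r * (nk + 2 * L)) ≤
          (τ * w i - τ * w z + (1 + wt z)) * n :=
        mul_le_mul_of_nonneg_left (by linarith) (by linarith)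
      have h9 : (τ * w i - τ * w z + (1 + wt z)) * (r * (nk + 2 * L)) =
          (τ * w i - τ * w z) * (r - 1) * (nk + 2 * L) + (1 + τ * w i) * (nk + 2 * L) := by
        linear_combination (nk + 2 * L) * hrb
      have h10 := hwt1 i
      linarith
end

section
/- In the setting of the inductive construction, let d ≥ 2, w a weight vector, τ > 1, δ ∈ (0, min{δ_0, τw_1/(1+τw_1)}), w̃ the auxiliary weight vector, and let ξ ≥ (1+τw_d)/(1+w̃_1) + 1 be a fixed integer. For R > (8(d+1)!)^{1/(1+w̃_1)} set ρ := Π_{i=1}^d ⌊R^{1+w̃_i}⌋ and ρ_0^{(1)} := R^{−(1+w̃_1)}/(d+1)!, and let (n_k)_{k≥1}, (n_k^{(i)}) be sequences as in the construction (n_k^{(i)} = ⌊((1+τw_i)/(1+w̃_i))(n_k − 2 log_R ε_{k−1})⌋ + 1 with n_k satisfying the prescribed lower bound in terms of ε_{k−1}). Then there exist constants ε̄_0 > 0 and R_0 > 0, depending only on d, δ, τ, w, w̃, ξ, such that: (1) for every 0 < ε < ε̄_0 and every R ≥ R_0, for all k ∈ ℕ, ρ^{−(ξ n_k^{(d)}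 − n_k^{(d)} − 1)(1−ε)} ≤ 2^{−(3d+1)} ρ_0^{(1)} R^{(τw_1 − w̃_1) n_k^{(1)}} R^{−(d+1)(ξ n_k^{(d)} − n_k^{(d)} − 1)}; and (2) for each fixed 0 < ε < ε̄_0 there exists R(ε) such that for every R ≥ R(ε) and all k ∈ ℕ, ρ^{−(ξ n_k^{(d)} − n_k^{(d)} − 1)ε/2} ≤ 1/2. -/
open Real Set

lemma aux_L (d : ℕ) (T t α' R εp F B : ℝ) (nk : ℕ) (ht : 0 < t) (ht1 : t ≤ 1)
    (hT : t < T) (hα : 0 < α') (hα1 : α' ≤ 1) (hd : 2 ≤ d) (hR : 1 < R) (hF : 1 ≤ F)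
    (he : 0 < εp) (he2 : εp ≤ R ^ (-(2 * (1 + 1 / t))) * F ^ (-(1 / t)))
    (hn : -(max (max ((2 * (1 + T) / (1 + t) + d + 1) /
            (α' * (T - t) * (1 - 1 / (1 + t)))) 4) B) * Real.logb R εp ≤ (nk : ℝ)) :
    1 ≤ (nk : ℝ) - 2 * Real.logb R εp ∧
      4 * (1 + t) ≤ (T - t) * ((nk : ℝ) - 2 * Real.logb R εp) := by
  have hd' : (2 : ℝ) ≤ d := by exact_mod_cast hd
  have h1 : F ^ (-(1 / t)) ≤ 1 :=
    Real.rpow_le_one_of_one_le_of_nonpos hF (by have : 0 < 1 / t := by positivity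
                                                linarith)
  have hRp : 0 < R ^ (-(2 * (1 + 1 / t))) := Real.rpow_pos_of_pos (by linarith) _
  have h2 : εp ≤ R ^ (-(2 * (1 + 1 / t))) :=
    he2.trans (by nlinarith)
  have h3 : Real.logb R εp ≤ -(2 * (1 + 1 / t)) := by
    rw [Real.logb_le_iff_le_rpow hR he]; exact h2
  set X := (2 * (1 + T) / (1 + t) + d + 1) / (α' * (T - t) * (1 - 1 / (1 + t))) with hX
  have hmx : X ≤ max (max X 4) B := (le_max_left _ _).trans (le_max_left _ _)
  set g := Real.logb R εp with hg
  have hit : 1 ≤ 1 / t := by rw [le_div_iff₀ ht]; linarith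
  have hg4 : g ≤ -4 := by linarith
  have hnk : (0 : ℝ) ≤ nk := Nat.cast_nonneg _
  have hXn : X * (-g) ≤ nk := by nlinarith
  have hs : 1 - 1 / (1 + t) = t / (1 + t) := by field_simp; ring
  have hs0 : 0 < t / (1 + t) := by positivity
  have hs1 : t / (1 + t) ≤ 1 := by rw [div_le_one (by linarith)]; linarith
  have hDp : 0 < T - t := by linarith
  have hXD : 3 ≤ X * (T - t) := by
    have hc : 0 < 2 * (1 + T) / (1 + t) := by
      have : 0 < T := by linarith
      positivity
    have e : X * (T - t) = (2 * (1 + T) / (1 + t) + d + 1) / (α' * (t / (1 + t))) := by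
      rw [hX, hs]; field_simp
    rw [e, le_div_iff₀ (by positivity)]
    have : α' * (t / (1 + t)) ≤ 1 := by nlinarith
    nlinarith
  refine ⟨by linarith, ?_⟩
  have h5 : (T - t) * (X * (-g)) ≤ (T - t) * nk := by gcongr
  have h6 : 3 * (-g) ≤ (X * (T - t)) * (-g) := by
    apply mul_le_mul_of_nonneg_right hXD; linarith
  nlinarith

lemma aux_rho (d : ℕ) (wt : Fin d → ℝ) (hp : ∀ i, 0 < wt i) (hs : ∑ i, wt i = 1) (R : ℝ)
    (hR : 2 ≤ R) :
    0 < (∏ i, (⌊R ^ (1 + wt i)⌋₊ : ℝ)) ∧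
    ((d : ℝ) + 1) * Real.log R - d * Real.log 2 ≤ Real.log (∏ i, (⌊R ^ (1 + wt i)⌋₊ : ℝ)) := by
  have key : ∀ i, 0 < R ^ (1 + wt i) / 2 ∧ R ^ (1 + wt i) / 2 ≤ (⌊R ^ (1 + wt i)⌋₊ : ℝ) := by
    intro i
    have h1 : R ≤ R ^ (1 + wt i) := Real.self_le_rpow_of_one_le (by linarith) (by linarith [hp i])
    have h2 := Nat.sub_one_lt_floor (R ^ (1 + wt i))
    constructor <;> linarith
  have hpos : ∀ i, (0 : ℝ) < (⌊R ^ (1 + wt i)⌋₊ : ℝ) := fun i => (key i).1.trans_le (key i).2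
  refine ⟨Finset.prod_pos fun i _ => hpos i, ?_⟩
  rw [Real.log_prod (fun i _ => (hpos i).ne')]
  have : ∀ i ∈ Finset.univ, (1 + wt i) * Real.log R - Real.log 2 ≤
      Real.log (⌊R ^ (1 + wt i)⌋₊ : ℝ) := by
    intro i _
    have := Real.log_le_log (key i).1 (key i).2
    rwa [Real.log_div (Real.rpow_pos_of_pos (by linarith) _).ne' (by norm_num),
      Real.log_rpow (by linarith)] at this
  refine le_trans (le_of_eq ?_) (Finset.sum_le_sum this)
  rw [Finset.sum_sub_distrib, ← Finset.sum_mul, Finset.sum_add_distrib, hs]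
  simp

lemma aux_arith (d : ℝ) (hd : 0 ≤ d) (l lr M N L ε C F D t g : ℝ) (hg : 0 ≤ g)
    (hlr : (d + 1) * l - d * g ≤ lr) (hM : 0 ≤ M) (hMC : M ≤ C * L) (hLN : L ≤ N) (hD : 0 < D)
    (ht : 0 ≤ t) (hDL : 4 * (1 + t) ≤ D * L) (hL : 1 ≤ L) (hε : 0 < ε) (hε1 : ε < 1) (hl : 0 < l)
    (h1 : ε * (d + 1) * C ≤ D / 4) (h2 : 4 * d * C * g ≤ D * l) (h3 : (3 * d + 1) * g + F ≤ l) :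
    -(M * (1 - ε)) * lr ≤ -(3 * d + 1) * g + (-(1 + t) * l - F) + D * N * l
      + (-(d + 1) * M) * l := by
  have a1 : M * (1 - ε) * ((d + 1) * l - d * g) ≤ M * (1 - ε) * lr :=
    mul_le_mul_of_nonneg_left hlr (mul_nonneg hM (by linarith))
  have a2 : M * (ε * (d + 1) * l) ≤ C * L * (ε * (d + 1) * l) :=
    mul_le_mul_of_nonneg_right hMC (by positivity)
  have a3 : (ε * (d + 1) * C) * (L * l) ≤ D / 4 * (L * l) :=
    mul_le_mul_of_nonneg_right h1 (by positivity)
  have a4 : M * (d * g) ≤ C * L * (d * g) := mul_le_mul_of_nonneg_right hMC (by positivity)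
  have a5 : (4 * d * C * g) * L ≤ D * l * L := mul_le_mul_of_nonneg_right h2 (by positivity)
  have a6 : 0 ≤ M * ε * (d * g) := by positivity
  have a7 : D * l * L ≤ D * l * N := mul_le_mul_of_nonneg_left hLN (by positivity)
  have a8 : 4 * (1 + t) * l ≤ D * L * l := mul_le_mul_of_nonneg_right hDL hl.le
  have a9 : 0 ≤ t * l := by positivity
  nlinarith

/-- Bounds on the exponent `M = ξ n - n - 1`. -/
lemma aux_M (c L ξ : ℝ) (hc : 1 ≤ c) (hL : 1 ≤ L) (hξ : 2 ≤ ξ) :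
    1 ≤ ξ * ((⌊c * L⌋ + 1 : ℤ) : ℝ) - ((⌊c * L⌋ + 1 : ℤ) : ℝ) - 1 ∧
    ξ * ((⌊c * L⌋ + 1 : ℤ) : ℝ) - ((⌊c * L⌋ + 1 : ℤ) : ℝ) - 1 ≤ (ξ - 1) * (c + 1) * L := by
  have h1 : (1 : ℝ) ≤ (⌊c * L⌋ : ℝ) := by
    have : (1 : ℤ) ≤ ⌊c * L⌋ := by rw [Int.le_floor]; push_cast; nlinarith
    exact_mod_cast this
  have h2 := Int.floor_le (c * L)
  push_cast
  generalize (⌊c * L⌋ : ℝ) = f at *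
  constructor
  · nlinarith
  · have : (ξ - 1) * (f + 1) ≤ (ξ - 1) * (c * L + L) :=
      mul_le_mul_of_nonneg_left (by linarith) (by linarith)
    nlinarith

lemma aux_setup (d : ℕ) (hd : 2 ≤ d) (w : Fin d → ℝ)
    (hw0 : ∀ i, 0 < w i) (hw1 : ∀ i, w i < 1) (hwmono : Monotone w) (τ : ℝ) (hτ : 1 < τ)
    (δ : ℝ) (hδ : 0 < δ) (K : ℕ) (hK : K < d) (wt : Fin d → ℝ) (htpos : ∀ i, 0 < wt i)
    (ht1 : ∀ i : Fin d, (i : ℕ) < K → wt i = τ * w i - δ * (1 + τ * w i))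
    (ht2b : ∀ i : Fin d, K ≤ (i : ℕ) → wt i = wt ⟨K, hK⟩)
    (ht2c : wt ⟨K, hK⟩ < τ * w ⟨K, hK⟩ - δ * (1 + τ * w ⟨K, hK⟩))
    (ht3 : ∑ i, wt i = 1)
    (i0 : Fin d) (α' : ℝ)
    (h0 : ∀ j, i0 ≤ j)
    (hα'1 : (∃ j : Fin d, w j ≠ w i0) →
      IsLeast {t : ℝ | ∃ j : Fin d, w j ≠ w i0 ∧ t = w j - w i0} α')
    (hα'2 : (∀ j : Fin d, w j = w i0) → α' = 1) :
    (∀ i, wt i < τ * w i) ∧ (∀ i, wt i ≤ 1) ∧ 0 < α' ∧ α' ≤ 1 := by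
  refine ⟨fun i => ?_, fun i => ?_, ?_⟩
  · have hp : ∀ j, 0 < δ * (1 + τ * w j) := fun j => by have := hw0 j; positivity
    by_cases h : (i : ℕ) < K
    · rw [ht1 i h]; linarith [hp i]
    · push Not at h
      rw [ht2b i h]
      have : w ⟨K, hK⟩ ≤ w i := hwmono h
      have : τ * w ⟨K, hK⟩ ≤ τ * w i := by gcongr
      linarith [hp ⟨K, hK⟩]
  · rw [← ht3]
    exact Finset.single_le_sum (fun j _ => (htpos j).le) (Finset.mem_univ i)
  · by_cases h : ∃ j : Fin d, w j ≠ w i0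
    · obtain ⟨j, hj, e⟩ := (hα'1 h).1
      have := hwmono (h0 j)
      have h3 : w i0 < w j := lt_of_le_of_ne this (Ne.symm hj)
      constructor
      · linarith
      · linarith [hw1 j, hw0 i0]
    · push Not at h
      rw [hα'2 h]; norm_num

/-- The uniform smallness estimates needed to discard the extra bad boxes in the
weighted Cantor-set construction. -/
theorem newlem_estimates (d : ℕ) (hd : 2 ≤ d) (w : Fin d → ℝ)
    (hw0 : ∀ i, 0 < w i) (hw1 : ∀ i, w i < 1) (hwmono : Monotone w)
    (hwsum : ∑ i, w i = 1) (τ : ℝ) (hτ : 1 < τ)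
    (δ : ℝ) (hδ : 0 < δ)
    (hδ' : δ < τ * w ⟨0, by omega⟩ / (1 + τ * w ⟨0, by omega⟩))
    (K : ℕ) (hK : K < d) (wt : Fin d → ℝ) (htpos : ∀ i, 0 < wt i)
    -- (τ1)–(τ3) for the auxiliary weight vector wt = w̃
    (ht1 : ∀ i : Fin d, (i : ℕ) < K → wt i = τ * w i - δ * (1 + τ * w i))
    (ht2a : ∀ i : Fin d, (i : ℕ) < K → wt i ≤ wt ⟨K, hK⟩)
    (ht2b : ∀ i : Fin d, K ≤ (i : ℕ) → wt i = wt ⟨K, hK⟩)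
    (ht2c : wt ⟨K, hK⟩ < τ * w ⟨K, hK⟩ - δ * (1 + τ * w ⟨K, hK⟩))
    (ht3 : ∑ i, wt i = 1)
    (α' : ℝ)
    (hα'1 : (∃ j : Fin d, w j ≠ w ⟨0, by omega⟩) →
      IsLeast {t : ℝ | ∃ j : Fin d, w j ≠ w ⟨0, by omega⟩ ∧ t = w j - w ⟨0, by omega⟩} α')
    (hα'2 : (∀ j : Fin d, w j = w ⟨0, by omega⟩) → α' = 1)
    (ξ : ℕ)
    (hξ : (1 + τ * w ⟨d - 1, by omega⟩) / (1 + wt ⟨0, by omega⟩) + 1 ≤ (ξ : ℝ)) :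
    ∃ εbar : ℝ, 0 < εbar ∧ ∃ R₀ : ℝ, 0 < R₀ ∧
      -- (1)
      (∀ ε : ℝ, 0 < ε → ε < εbar → ∀ R : ℝ, R₀ ≤ R →
        (8 * (Nat.factorial (d + 1) : ℝ)) ^ ((1 : ℝ) / (1 + wt ⟨0, by omega⟩)) < R →
        ∀ εp : ℝ, 0 < εp →
        εp ≤ R ^ (-(2 * (1 + 1 / wt ⟨0, by omega⟩))) *
          ((Nat.factorial (d + 1) : ℝ)) ^ (-(1 / wt ⟨0, by omega⟩)) →
        ∀ nk : ℕ,
        -(max (max ((2 * (1 + τ * w ⟨0, by omega⟩) / (1 + wt ⟨0, by omega⟩) + d + 1) /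
            (α' * (τ * w ⟨0, by omega⟩ - wt ⟨0, by omega⟩) * (1 - 1 / (1 + wt ⟨0, by omega⟩)))) 4)
            (2 / (τ - 1))) * Real.logb R εp ≤ (nk : ℝ) →
        (∏ i, (⌊R ^ (1 + wt i)⌋₊ : ℝ)) ^
            (-(((ξ : ℝ) * ((nkIdx w wt τ R εp nk ⟨d - 1, by omega⟩ : ℤ) : ℝ) -
              ((nkIdx w wt τ R εp nk ⟨d - 1, by omega⟩ : ℤ) : ℝ) - 1) * (1 - ε))) ≤
          (2 : ℝ) ^ (-(3 * (d : ℝ) + 1)) *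
            (R ^ (-(1 + wt ⟨0, by omega⟩)) / (Nat.factorial (d + 1) : ℝ)) *
            R ^ ((τ * w ⟨0, by omega⟩ - wt ⟨0, by omega⟩) *
              ((nkIdx w wt τ R εp nk ⟨0, by omega⟩ : ℤ) : ℝ)) *
            R ^ (-((d : ℝ) + 1) *
              ((ξ : ℝ) * ((nkIdx w wt τ R εp nk ⟨d - 1, by omega⟩ : ℤ) : ℝ) -
                ((nkIdx w wt τ R εp nk ⟨d - 1, by omega⟩ : ℤ) : ℝ) - 1))) ∧
      -- (2)
      (∀ ε : ℝ, 0 < ε → ε < εbar → ∃ Rε : ℝ, ∀ R : ℝ, Rε ≤ R →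
        (8 * (Nat.factorial (d + 1) : ℝ)) ^ ((1 : ℝ) / (1 + wt ⟨0, by omega⟩)) < R →
        ∀ εp : ℝ, 0 < εp →
        εp ≤ R ^ (-(2 * (1 + 1 / wt ⟨0, by omega⟩))) *
          ((Nat.factorial (d + 1) : ℝ)) ^ (-(1 / wt ⟨0, by omega⟩)) →
        ∀ nk : ℕ,
        -(max (max ((2 * (1 + τ * w ⟨0, by omega⟩) / (1 + wt ⟨0, by omega⟩) + d + 1) /
            (α' * (τ * w ⟨0, by omega⟩ - wt ⟨0, by omega⟩) * (1 - 1 / (1 + wt ⟨0, by omega⟩)))) 4)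
            (2 / (τ - 1))) * Real.logb R εp ≤ (nk : ℝ) →
        (∏ i, (⌊R ^ (1 + wt i)⌋₊ : ℝ)) ^
            (-(((ξ : ℝ) * ((nkIdx w wt τ R εp nk ⟨d - 1, by omega⟩ : ℤ) : ℝ) -
              ((nkIdx w wt τ R εp nk ⟨d - 1, by omega⟩ : ℤ) : ℝ) - 1) * ε / 2)) ≤ 1 / 2) := by
  obtain ⟨hT, hle1, hα0, hα1⟩ := aux_setup d hd w hw0 hw1 hwmono τ hτ δ hδ K hK wt htpos ht1 ht2b
    ht2c ht3 ⟨0, by omega⟩ α' (fun j => Nat.zero_le _) hα'1 hα'2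
  have hlast : w ⟨0, by omega⟩ ≤ w ⟨d - 1, by omega⟩ := hwmono (Nat.zero_le _)
  generalize hi0 : (⟨0, by omega⟩ : Fin d) = i0 at *
  generalize hi1 : (⟨d - 1, by omega⟩ : Fin d) = i1 at *
  have hF1 : (1 : ℝ) ≤ (Nat.factorial (d + 1) : ℝ) := by
    exact_mod_cast Nat.one_le_iff_ne_zero.mpr (Nat.factorial_ne_zero _)
  generalize (Nat.factorial (d + 1) : ℝ) = F at *
  have hd0 : (0 : ℝ) ≤ d := Nat.cast_nonneg d
  have ht0 := htpos i0
  have hc0 : 1 ≤ (1 + τ * w i0) / (1 + wt i0) := by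
    rw [le_div_iff₀ (by linarith)]; linarith [hT i0]
  have hc1 : 1 ≤ (1 + τ * w i1) / (1 + wt i1) := by
    rw [le_div_iff₀ (by linarith [htpos i1])]; linarith [hT i1]
  have hξ2 : (2 : ℝ) ≤ ξ := by
    have h1 : 1 ≤ (1 + τ * w i1) / (1 + wt i0) := by
      rw [le_div_iff₀ (by linarith)]
      have : τ * w i0 ≤ τ * w i1 := by gcongr
      linarith [hT i0]
    linarith
  set C : ℝ := ((ξ : ℝ) - 1) * ((1 + τ * w i1) / (1 + wt i1) + 1) with hC
  have hCpos : 0 < C := mul_pos (by linarith) (by linarith)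
  have hD : 0 < τ * w i0 - wt i0 := by linarith [hT i0]
  set D := τ * w i0 - wt i0 with hDdef
  have hg : 0 < Real.log 2 := Real.log_pos (by norm_num)
  refine ⟨min 1 (D / 4 / ((d + 1) * C)), by positivity,
    max 2 (max (Real.exp (4 * d * C * Real.log 2 / D))
      (Real.exp ((3 * d + 1) * Real.log 2 + Real.log F))), by positivity, ?_, ?_⟩
  · intro ε hε hεb R hR _ εp hεp hεp2 nk hnk
    have hR2 : 2 ≤ R := (le_max_left _ _).trans hR
    have hRp : 0 < R := by linarith
    have hl1 : 4 * d * C * Real.log 2 / D ≤ Real.log R := by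
      rw [Real.le_log_iff_exp_le hRp]
      exact ((le_max_left _ _).trans (le_max_right _ _)).trans hR
    have hl2 : (3 * d + 1) * Real.log 2 + Real.log F ≤ Real.log R := by
      rw [Real.le_log_iff_exp_le hRp]
      exact ((le_max_right _ _).trans (le_max_right _ _)).trans hR
    obtain ⟨hL1, hL2⟩ := aux_L d (τ * w i0) (wt i0) α' R εp F _ nk ht0 (hle1 i0) (hT i0) hα0 hα1
      hd (by linarith) hF1 hεp hεp2 hnk
    obtain ⟨hρ, hlρ⟩ := aux_rho d wt htpos ht3 R hR2
    unfold nkIdx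
    set L := (nk : ℝ) - 2 * Real.logb R εp with hL
    obtain ⟨hM1, hM2⟩ := aux_M _ L ξ hc1 hL1 hξ2
    have hN : L ≤ ((⌊(1 + τ * w i0) / (1 + wt i0) * L⌋ + 1 : ℤ) : ℝ) := by
      push_cast
      have := Int.lt_floor_add_one ((1 + τ * w i0) / (1 + wt i0) * L)
      nlinarith
    generalize ((⌊(1 + τ * w i0) / (1 + wt i0) * L⌋ + 1 : ℤ) : ℝ) = N at *
    generalize hMd : (ξ : ℝ) * ((⌊(1 + τ * w i1) / (1 + wt i1) * L⌋ + 1 : ℤ) : ℝ) -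
      ((⌊(1 + τ * w i1) / (1 + wt i1) * L⌋ + 1 : ℤ) : ℝ) - 1 = M at *
    generalize (∏ i, (⌊R ^ (1 + wt i)⌋₊ : ℝ)) = ρ at *
    have hε4 : ε * (d + 1) * C ≤ D / 4 := by
      have := hεb.trans_le (min_le_right _ _)
      rw [lt_div_iff₀ (by positivity)] at this
      linarith
    have hfin := aux_arith d hd0 (Real.log R) (Real.log ρ) M N L ε C (Real.log F) D (wt i0)
      (Real.log 2) hg.le hlρ (by linarith) hM2 hN hD ht0.le hL2 hL1 hε
      (hεb.trans_le (min_le_left _ _)) (Real.log_pos (by linarith)) hε4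
      (by rw [div_le_iff₀ hD] at hl1; linarith) hl2
    have hFp : 0 < F := by linarith
    have e2 : ∀ (x y : ℝ), 0 < x → x ^ y = Real.exp (y * Real.log x) := fun x y hx => by
      rw [Real.rpow_def_of_pos hx, mul_comm]
    have eF : ∀ x : ℝ, x / F = x * Real.exp (-Real.log F) := fun x => by
      rw [Real.exp_neg, Real.exp_log hFp, div_eq_mul_inv]
    rw [e2 ρ _ hρ, e2 2 _ (by norm_num), eF, e2 R _ hRp, e2 R _ hRp, e2 R _ hRp,
      ← Real.exp_add, ← Real.exp_add, ← Real.exp_add, ← Real.exp_add, Real.exp_le_exp]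
    linarith
  · intro ε hε hεb
    refine ⟨max 2 (Real.exp (2 * Real.log 2 / ε)), ?_⟩
    intro R hR _ εp hεp hεp2 nk hnk
    have hR2 : 2 ≤ R := (le_max_left _ _).trans hR
    have hRp : 0 < R := by linarith
    have hl1 : 2 * Real.log 2 / ε ≤ Real.log R := by
      rw [Real.le_log_iff_exp_le hRp]
      exact (le_max_right _ _).trans hR
    obtain ⟨hL1, hL2⟩ := aux_L d (τ * w i0) (wt i0) α' R εp F _ nk ht0 (hle1 i0) (hT i0) hα0 hα1
      hd (by linarith) hF1 hεp hεp2 hnk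
    obtain ⟨hρ, hlρ⟩ := aux_rho d wt htpos ht3 R hR2
    unfold nkIdx
    set L := (nk : ℝ) - 2 * Real.logb R εp with hL
    obtain ⟨hM1, hM2⟩ := aux_M _ L ξ hc1 hL1 hξ2
    generalize hMd : (ξ : ℝ) * ((⌊(1 + τ * w i1) / (1 + wt i1) * L⌋ + 1 : ℤ) : ℝ) -
      ((⌊(1 + τ * w i1) / (1 + wt i1) * L⌋ + 1 : ℤ) : ℝ) - 1 = M at *
    generalize (∏ i, (⌊R ^ (1 + wt i)⌋₊ : ℝ)) = ρ at *
    have hlR : Real.log 2 ≤ Real.log R := Real.log_le_log (by norm_num) hR2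
    have hlρ2 : Real.log R ≤ Real.log ρ := by
      have := mul_le_mul_of_nonneg_left hlR hd0
      linarith
    have e : (1 / 2 : ℝ) = Real.exp (-Real.log 2) := by
      rw [Real.exp_neg, Real.exp_log (by norm_num)]; norm_num
    rw [Real.rpow_def_of_pos hρ, e, Real.exp_le_exp]
    rw [div_le_iff₀ hε] at hl1
    have b1 : Real.log R * ε ≤ Real.log ρ * ε := by gcongr
    have b2 : Real.log ρ * ε * 1 ≤ Real.log ρ * ε * M := by
      apply mul_le_mul_of_nonneg_left hM1
      exact mul_nonneg (by linarith) hε.le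
    linarith
end

section
/- Let w, w̃ ∈ (0,1)^d with 0 < w_1 ≤ … ≤ w_d, 0 < w̃_1 ≤ … ≤ w̃_d, and let τ > 1 satisfy τw_1 − w̃_1 > 0 and (1+τw_1)/(1+w̃_1) ≤ (1+τw_i)/(1+w̃_i) for all i (hence τw_1 − w̃_1 ≤ τw_i − w̃_i for all i). Let R > 1, n ∈ ℕ, and 0 < ε < 1/(d+1)! with R^{(τw_1 − w̃_1)n} ≥ ε^{−(d+1)}. Let x ∈ ℝ^d be such that ‖sx − r‖_{w̃} > ε/s for every (r,s) ∈ ℤ^d × ℕ with 1 ≤ s ≤ R^n. Then the set of integer vectors (r, s) ∈ ℤ^{d+1} satisfying |s x_i − r_i| ≤ R^{−(w̃_i − w̃_1)n} R^{−τ w_1 n} for all i = 1,…,d and |s| ≤ R^{(1 + τw_1 − w̃_1)n} ε^d spans a linear subspace of ℝ^{d+1} of dimension at most 1. -/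
open Real Set

/-- Elementary polynomial inequality used for `d = 1`. -/
lemma aux_poly (a ρ : ℝ) (ha0 : 0 < a) (ha1 : a < 1) (h0 : 0 < ρ) (h1 : ρ ≤ 1) :
    4 * a * (1 - a + a * ρ) ≤ (1 + ρ * (1 - a + a * ρ)) * (1 + a ^ 2) := by
  obtain ⟨σ, rfl⟩ : ∃ σ, ρ = 1 - σ := ⟨1 - ρ, by ring⟩
  have hs0 : 0 ≤ σ := by linarith
  have hs1 : σ < 1 := by linarith
  nlinarith [sq_nonneg (1 - a), sq_nonneg (2 * (1 - a) - σ), sq_nonneg ((1 - a) - σ),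
    mul_nonneg hs0 (sq_nonneg (1 - a)), mul_nonneg ha0.le (sq_nonneg (1 - a)),
    mul_nonneg ha0.le (sq_nonneg (1 - a - σ)), mul_nonneg ha0.le (sq_nonneg (2 * (1 - a) - σ)),
    sq_nonneg (a * σ - (1 - a)), mul_nonneg (mul_nonneg hs0 ha0.le) (sub_nonneg.2 ha1.le),
    mul_nonneg (sub_nonneg.2 hs1.le) (sq_nonneg (1 - 2 * a)),
    mul_nonneg (sub_nonneg.2 ha1.le) (sq_nonneg (a * σ - (1 - a))),
    mul_nonneg (sub_nonneg.2 ha1.le) (sq_nonneg (1 - a - σ))]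

lemma aux_rho_s12 (a ρ : ℝ) (ha0 : 0 < a) (ha1 : a < 1) (h0 : 0 < ρ) (h1 : ρ ≤ 1) :
    4 * a / (1 + a ^ 2) ≤ (ρ ^ a)⁻¹ + ρ := by
  have hg : ρ ^ a ≤ 1 - a + a * ρ := by
    have := Real.geom_mean_le_arith_mean2_weighted (w₁ := 1 - a) (w₂ := a) (p₁ := 1) (p₂ := ρ)
      (by linarith) ha0.le (by norm_num) h0.le (by ring)
    simpa using this
  have hpos : 0 < ρ ^ a := Real.rpow_pos_of_pos h0 a
  have h2 : (1 - a + a * ρ)⁻¹ ≤ (ρ ^ a)⁻¹ := inv_anti₀ hpos hg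
  have hgp : 0 < 1 - a + a * ρ := by nlinarith
  refine le_trans ?_ (add_le_add_left h2 ρ)
  have : (1 - a + a * ρ)⁻¹ + ρ = (1 + ρ * (1 - a + a * ρ)) / (1 - a + a * ρ) := by
    field_simp
  rw [this, div_le_div_iff₀ (by positivity) hgp]
  exact aux_poly a ρ ha0 ha1 h0 h1

lemma aux_two (a : ℝ) (ha0 : 0 < a) (T : ℝ) (hT : 2 ≤ T) :
    (1 + a ^ 2) / (2 * a) ≤ T ^ ((1 - a) ^ 2 / a) := by
  have hu : 0 ≤ (1 - a) ^ 2 / a := by positivity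
  have h1 : (2 : ℝ) ^ ((1 - a) ^ 2 / a) ≤ T ^ ((1 - a) ^ 2 / a) :=
    Real.rpow_le_rpow (by norm_num) hT hu
  refine le_trans ?_ h1
  rw [Real.rpow_def_of_pos (by norm_num)]
  have h2 := Real.add_one_le_exp (Real.log 2 * ((1 - a) ^ 2 / a))
  have h3 := Real.log_two_gt_d9
  have h4 : (1 + a ^ 2) / (2 * a) = (1 / 2) * ((1 - a) ^ 2 / a) + 1 := by
    field_simp; ring
  rw [h4]
  nlinarith

/-- Neighbouring fraction. -/
lemma aux_nbr (q : ℕ) (hq : 2 ≤ q) (r : ℤ) (hc : IsCoprime r (q : ℤ)) (x : ℝ)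
    (hD : |(q : ℝ) * x - r| ≤ 1 / (q : ℝ)) :
    ∃ (p : ℕ) (m : ℤ), 1 ≤ p ∧ p < q ∧
      (q : ℝ) * |(p : ℝ) * x - m| + p * |(q : ℝ) * x - r| = 1 := by
  have key : ∀ σ : ℤ, (σ = 1 ∨ σ = -1) → ∃ (p : ℕ) (m : ℤ), 1 ≤ p ∧ p < q ∧
      (p : ℤ) * r - q * m = σ := by
    intro σ hσ
    obtain ⟨u, v, huv⟩ := hc
    have hq0 : (0 : ℤ) < q := by omega
    have hmod := Int.emod_nonneg (σ * u) hq0.ne'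
    have hlt := Int.emod_lt_of_pos (σ * u) hq0
    have hdm := Int.emod_add_mul_ediv (σ * u) q
    obtain ⟨p, hp⟩ := Int.eq_ofNat_of_zero_le hmod
    set k := (σ * u) / (q : ℤ)
    rw [hp] at hdm hlt
    have heq : (p : ℤ) * r - q * (-σ * v - k * r) = σ := by
      have : (p : ℤ) = σ * u - q * k := by linarith
      rw [this]; linear_combination σ * huv
    refine ⟨p, -σ * v - k * r, ?_, by exact_mod_cast hlt, heq⟩
    by_contra h0
    have hp0 : p = 0 := by omega
    subst hp0
    have hdvd : (q : ℤ) ∣ σ := ⟨-(-σ * v - k * r), by linear_combination -heq⟩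
    have hd1 : (q : ℤ) ∣ 1 := by
      rcases hσ with h | h
      · rwa [h] at hdvd
      · rw [h] at hdvd; exact (dvd_neg.1 hdvd)
    have := Int.le_of_dvd one_pos hd1
    omega
  have hqR : (0 : ℝ) < q := by exact_mod_cast (by omega : 0 < q)
  have main : ∀ (p : ℕ) (m : ℤ), p < q → (p : ℝ) * |(q : ℝ) * x - r| ≤ 1 := by
    intro p m hp
    have hpR : (p : ℝ) ≤ q := by exact_mod_cast hp.le
    calc (p : ℝ) * |(q : ℝ) * x - r| ≤ q * (1 / q) := by gcongr
      _ = 1 := by field_simp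
  rcases le_total 0 ((q : ℝ) * x - r) with h | h
  · obtain ⟨p, m, hp1, hpq, he⟩ := key (-1) (Or.inr rfl)
    refine ⟨p, m, hp1, hpq, ?_⟩
    have hb := main p m hpq
    have heR : (p : ℝ) * r - q * m = -1 := by exact_mod_cast he
    rw [abs_of_nonneg h] at hb ⊢
    have : (q : ℝ) * |(p : ℝ) * x - m| = |(q : ℝ) * (p * x - m)| := by
      rw [abs_mul, abs_of_pos hqR]
    rw [this, show (q : ℝ) * (p * x - m) = -(1 - p * (q * x - r)) by linear_combination heR,
      abs_neg, abs_of_nonneg (by linarith)]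
    ring
  · obtain ⟨p, m, hp1, hpq, he⟩ := key 1 (Or.inl rfl)
    refine ⟨p, m, hp1, hpq, ?_⟩
    have hb := main p m hpq
    have heR : (p : ℝ) * r - q * m = 1 := by exact_mod_cast he
    rw [abs_of_nonpos h] at hb ⊢
    have : (q : ℝ) * |(p : ℝ) * x - m| = |(q : ℝ) * (p * x - m)| := by
      rw [abs_mul, abs_of_pos hqR]
    rw [this, show (q : ℝ) * (p * x - m) = (1 - p * (-(q * x - r))) by linear_combination heR,
      abs_of_nonneg (by linarith)]
    ring

/-- The one-dimensional approximation statement. -/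
lemma dim_one (a : ℝ) (ha0 : 0 < a) (ha1 : a < 1) (T : ℝ) (hT : 1 ≤ T) (x : ℝ) :
    ∃ (s : ℕ) (r : ℤ), 1 ≤ s ∧ (s : ℝ) ≤ T ∧
      |(s : ℝ) * x - r| ≤ (T ^ (a - 1) / (2 * s)) ^ a := by
  by_contra! hcon
  have hT0 : 0 < T := by linarith
  have hN : 0 < ⌊T⌋₊ := Nat.floor_pos.2 hT
  obtain ⟨ξ, hξ, hden⟩ := Real.exists_rat_abs_sub_le_and_den_le x hN
  set q := ξ.den with hqdef
  have hq1 : 1 ≤ q := ξ.den_pos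
  have hqR : (0 : ℝ) < q := by exact_mod_cast hq1
  have hqT : (q : ℝ) ≤ T := le_trans (by exact_mod_cast hden) (Nat.floor_le hT0.le)
  have hDle : |(q : ℝ) * x - ξ.num| ≤ 1 / ((⌊T⌋₊ : ℝ) + 1) := by
    have h1 : (q : ℝ) * x - ξ.num = q * (x - ξ) := by
      have : (ξ : ℝ) = ξ.num / q := by rw [hqdef]; exact_mod_cast (Rat.num_div_den ξ).symm
      rw [this]; field_simp
    rw [h1, abs_mul, abs_of_pos hqR]
    calc (q : ℝ) * |x - ξ| ≤ q * (1 / (((⌊T⌋₊ : ℝ) + 1) * q)) := by gcongr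
      _ = _ := by field_simp
  have hDT : |(q : ℝ) * x - ξ.num| < 1 / T := by
    refine lt_of_le_of_lt hDle ?_
    exact one_div_lt_one_div_of_lt hT0 (Nat.lt_floor_add_one T)
  have hE := hcon q ξ.num hq1 hqT
  set D := |(q : ℝ) * x - ξ.num| with hDdef
  -- log form
  set L := Real.log T with hL
  have hL0 : 0 ≤ L := Real.log_nonneg hT
  have hlogE : ∀ t : ℝ, 0 < t → Real.log ((T ^ (a - 1) / (2 * t)) ^ a)
      = a * ((a - 1) * L - Real.log 2 - Real.log t) := by
    intro t ht
    rw [Real.log_rpow (by positivity), Real.log_div (by positivity) (by positivity),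
      Real.log_rpow hT0, Real.log_mul (by norm_num) ht.ne']
    ring
  have hEpos : 0 < (T ^ (a - 1) / (2 * q)) ^ a := by positivity
  have hl1 : a * ((a - 1) * L - Real.log 2 - Real.log q) < -L := by
    rw [← hlogE q hqR]
    have := Real.log_lt_log hEpos (hE.trans hDT)
    rwa [one_div, Real.log_inv] at this
  have hlog2 : 0 < Real.log 2 := Real.log_pos (by norm_num)
  rcases Nat.lt_or_ge q 2 with hq2 | hq2
  · have hq : q = 1 := by omega
    rw [hq] at hl1 hEpos
    simp only [Nat.cast_one, Real.log_one, sub_zero] at hl1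
    -- L (1 - a + a^2) < a log 2
    have hL2 : L < Real.log 2 := by nlinarith [mul_nonneg hL0 (sq_nonneg (1 - a))]
    have hT2 : T < 2 := (Real.log_lt_log_iff hT0 (by norm_num)).1 hL2
    have hfl : ⌊T⌋₊ = 1 := by
      rw [Nat.floor_eq_iff hT0.le]; constructor <;> norm_num <;> linarith
    rw [hfl] at hDle
    have h5 : a * ((a - 1) * L - Real.log 2 - Real.log q) < -Real.log 2 := by
      rw [← hlogE q hqR]
      have := Real.log_lt_log (by rw [hq]; exact hEpos) (hE.trans_le hDle)
      rw [one_div, Real.log_inv] at this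
      norm_num at this ⊢
      exact this
    rw [hq] at h5
    simp only [Nat.cast_one, Real.log_one, sub_zero] at h5
    -- log 2 (1-a) < a (1-a) L
    nlinarith [mul_pos (sub_pos.2 ha1) (sub_pos.2 hL2), mul_pos (mul_pos ha0 (sub_pos.2 ha1)) (sub_pos.2 hL2), mul_pos (sub_pos.2 ha1) (mul_pos (sub_pos.2 ha1) hlog2)]
  · have hT2 : 2 ≤ T := le_trans (by exact_mod_cast hq2) hqT
    have hcop : IsCoprime ξ.num (q : ℤ) := by
      rw [Int.isCoprime_iff_gcd_eq_one]
      exact ξ.reduced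
    obtain ⟨p, m, hp1, hpq, hpe⟩ := aux_nbr q hq2 ξ.num hcop x
      (hDT.le.trans (one_div_le_one_div_of_le hqR hqT))
    have hpR : (0 : ℝ) < p := by exact_mod_cast hp1
    have hpqR : (p : ℝ) ≤ q := by exact_mod_cast hpq.le
    have hP := hcon p m hp1 (hpqR.trans hqT)
    set E := (T ^ (a - 1) / (2 * q)) ^ a with hEdef
    have hPE : (T ^ (a - 1) / (2 * p)) ^ a = E * (((p : ℝ) / q) ^ a)⁻¹ := by
      rw [hEdef, ← Real.inv_rpow (by positivity), ← Real.mul_rpow (by positivity) (by positivity)]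
      congr 1
      field_simp
    have h6 : (q * E) * ((((p : ℝ) / q) ^ a)⁻¹ + (p : ℝ) / q) < 1 := by
      rw [← hpe]
      calc (q * E) * ((((p : ℝ) / q) ^ a)⁻¹ + (p : ℝ) / q)
          = q * (E * (((p : ℝ) / q) ^ a)⁻¹) + p * E := by field_simp
        _ < _ := by
          rw [← hPE]
          have := mul_lt_mul_of_pos_left hP hqR
          have := mul_lt_mul_of_pos_left hE hpR
          linarith
    have h7 : T ^ ((1 - a) ^ 2 / a) / 2 ≤ q * E := by
      rw [← Real.log_le_log_iff (by positivity) (by positivity),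
        Real.log_div (by positivity) (by norm_num), Real.log_rpow hT0,
        Real.log_mul hqR.ne' hEpos.ne', hlogE q hqR]
      -- log q > (a-1+1/a) L - log 2
      have h8 : (a - 1 + 1 / a) * L - Real.log 2 ≤ Real.log q := by
        have : a * ((a - 1 + 1 / a) * L - Real.log 2) ≤ a * Real.log q := by
          have h9 : a * ((a - 1 + 1 / a) * L - Real.log 2)
            = a * (a - 1) * L + L - a * Real.log 2 := by field_simp
          rw [h9]; linarith
        exact le_of_mul_le_mul_left this ha0
      have h10 := mul_le_mul_of_nonneg_left h8 (sub_pos.2 ha1).le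
      have h11 : (1 - a) ^ 2 / a * L
          = (1 - a) * ((a - 1 + 1 / a) * L) + a * (a - 1) * L := by
        field_simp; ring
      rw [h11]
      linarith
    have h12 := aux_two a ha0 T hT2
    have h13 := aux_rho_s12 a ((p : ℝ) / q) ha0 ha1 (by positivity) ((div_le_one hqR).2 hpqR)
    have h14 : (1 + a ^ 2) / (2 * a) / 2 * (4 * a / (1 + a ^ 2)) = 1 := by
      field_simp; norm_num
    have h15 : (1 + a ^ 2) / (2 * a) / 2 * (4 * a / (1 + a ^ 2)) ≤
        (q * E) * ((((p : ℝ) / q) ^ a)⁻¹ + (p : ℝ) / q) := by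
      apply mul_le_mul _ h13 (by positivity) (by positivity)
      linarith
    linarith

/-- Two integrally independent points in the body give a contradiction. -/
lemma core (d : ℕ) (hd : 1 ≤ d) (wt : Fin d → ℝ)
    (hwt0 : ∀ i, 0 < wt i) (hwt1 : ∀ i, wt i < 1)
    (T G : ℝ) (hT : 1 ≤ T) (ε : ℝ) (hε0 : 0 < ε) (hε1 : ε < 1 / 2) (hG : 1 ≤ G * ε ^ (d + 1))
    (x : Fin d → ℝ)
    (hx : ∀ (r : Fin d → ℤ) (s : ℕ), 1 ≤ s → (s : ℝ) ≤ T →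
      (∀ i, |(s : ℝ) * x i - r i| ≤ (ε / s) ^ wt i) → False)
    (r₁ r₂ : Fin d → ℤ) (s₁ s₂ : ℤ)
    (h₁ : ∀ i, |(s₁ : ℝ) * x i - r₁ i| ≤ T ^ (-wt i) / G)
    (h₂ : ∀ i, |(s₂ : ℝ) * x i - r₂ i| ≤ T ^ (-wt i) / G)
    (hs₁ : |(s₁ : ℝ)| ≤ T * (G * ε ^ d)) (hs₂ : |(s₂ : ℝ)| ≤ T * (G * ε ^ d))
    (hs : |s₁| ≤ |s₂|)
    (hind : ∀ m k : ℤ, (∀ i, m * r₁ i - k * r₂ i = 0) → m * s₁ - k * s₂ = 0 → m = 0 ∧ k = 0) :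
    False := by
  have hT0 : 0 < T := by linarith
  have hG0 : 0 < G := by
    by_contra h
    have := mul_nonpos_of_nonpos_of_nonneg (not_lt.1 h) (pow_nonneg hε0.le (d + 1))
    linarith
  have hGe : 2 ≤ G * ε ^ d := by
    rw [pow_succ] at hG
    have : 0 < G * ε ^ d := by positivity
    nlinarith
  rcases Nat.lt_or_ge d 2 with hd2 | hd2
  · -- d = 1
    obtain rfl : d = 1 := by omega
    set a := wt 0 with ha
    have hTa : 0 < T ^ (-a) := by positivity
    have hdet : s₂ * r₁ 0 - s₁ * r₂ 0 ≠ 0 := by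
      intro h0
      have := hind s₂ s₁ (fun i => by rw [Fin.fin_one_eq_zero i]; exact h0) (by ring)
      obtain ⟨e2, e1⟩ := this
      have hG1 : T ^ (-a) / G < 1 := by
        rw [div_lt_one hG0]
        have h1 : T ^ (-a) ≤ 1 := Real.rpow_le_one_of_one_le_of_nonpos hT (by linarith [hwt0 0])
        rw [pow_one] at hGe
        nlinarith
      have hr : |(r₁ 0 : ℝ)| < 1 := by
        have := (h₁ 0).trans_lt hG1
        rw [e1] at this
        simpa using this
      have hr' : |r₁ 0| < 1 := by exact_mod_cast hr
      have hr0 : r₁ 0 = 0 := Int.abs_lt_one_iff.1 hr'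
      have := hind 1 0 (fun i => by rw [Fin.fin_one_eq_zero i, hr0]; ring) (by rw [e1]; ring)
      exact one_ne_zero this.1
    have hdet1 : (1 : ℝ) ≤ |(s₂ : ℝ) * r₁ 0 - s₁ * r₂ 0| := by
      exact_mod_cast Int.one_le_abs hdet
    have hb : |(s₂ : ℝ) * r₁ 0 - s₁ * r₂ 0| ≤ 2 * (T * T ^ (-a)) * ε := by
      have e : (s₂ : ℝ) * r₁ 0 - s₁ * r₂ 0
        = s₁ * (s₂ * x 0 - r₂ 0) - s₂ * (s₁ * x 0 - r₁ 0) := by ring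
      rw [e]
      refine (abs_sub _ _).trans ?_
      rw [abs_mul, abs_mul]
      have b1 : |(s₁ : ℝ)| * |(s₂ : ℝ) * x 0 - r₂ 0| ≤ (T * (G * ε ^ 1)) * (T ^ (-a) / G) :=
        mul_le_mul hs₁ (h₂ 0) (abs_nonneg _) (by positivity)
      have b2 : |(s₂ : ℝ)| * |(s₁ : ℝ) * x 0 - r₁ 0| ≤ (T * (G * ε ^ 1)) * (T ^ (-a) / G) :=
        mul_le_mul hs₂ (h₁ 0) (abs_nonneg _) (by positivity)
      have b3 : (T * (G * ε ^ 1)) * (T ^ (-a) / G) = T * T ^ (-a) * ε := by field_simp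
      linarith
    obtain ⟨s, r, hs1, hsT, hsr⟩ := dim_one a (hwt0 0) (hwt1 0) T hT (x 0)
    refine hx (fun _ => r) s hs1 hsT (fun i => ?_)
    rw [Fin.fin_one_eq_zero i]
    refine hsr.trans ?_
    have hsR : (0 : ℝ) < s := by exact_mod_cast hs1
    apply Real.rpow_le_rpow (by positivity) _ (hwt0 0).le
    rw [← div_div]
    apply div_le_div_of_nonneg_right _ hsR.le
    have e1 : T ^ (a - 1) * (T * T ^ (-a)) = 1 := by
      rw [← mul_assoc, ← Real.rpow_add_one hT0.ne', ← Real.rpow_add hT0]; simp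
    have : T ^ (a - 1) * 1 ≤ T ^ (a - 1) * (2 * (T * T ^ (-a)) * ε) :=
      mul_le_mul_of_nonneg_left (hdet1.trans hb) (by positivity)
    nlinarith
  · -- d ≥ 2
    set M := G * ε ^ d with hM
    have hN : 0 < ⌊M⌋₊ := Nat.floor_pos.2 (by linarith)
    set N := ⌊M⌋₊ with hNdef
    have hNM : (N : ℝ) ≤ M := Nat.floor_le (by linarith)
    have hMN : M < N + 1 := Nat.lt_floor_add_one M
    obtain ⟨k, m, hm0, hmN, hmk⟩ :=
      Real.exists_int_int_abs_mul_sub_le ((s₁ : ℝ) / s₂) hN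
    have hsR : |(s₁ : ℝ)| ≤ |(s₂ : ℝ)| := by exact_mod_cast hs
    have hξ : |(s₁ : ℝ) / s₂| ≤ 1 := by
      rw [abs_div]; exact div_le_one_of_le₀ hsR (abs_nonneg _)
    have hmR : (0 : ℝ) < m := by exact_mod_cast hm0
    have hmNR : (m : ℝ) ≤ N := by exact_mod_cast hmN
    have hNR : (0 : ℝ) < N := by exact_mod_cast hN
    have hk : |k| ≤ m := by
      have : |(k : ℝ)| < m + 1 := by
        have e : (k : ℝ) = m * (s₁ / s₂) - (m * ((s₁ : ℝ) / s₂) - k) := by ring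
        rw [e]
        refine (abs_sub _ _).trans_lt ?_
        rw [abs_mul, abs_of_pos hmR]
        have : 1 / ((N : ℝ) + 1) < 1 := by rw [div_lt_one (by positivity)]; linarith
        nlinarith
      have h2 : |k| < m + 1 := by exact_mod_cast this
      omega
    have hkR : |(k : ℝ)| ≤ N := le_trans (by exact_mod_cast hk) hmNR
    have hS : |((m * s₁ - k * s₂ : ℤ) : ℝ)| ≤ T := by
      have e : ((m * s₁ - k * s₂ : ℤ) : ℝ) = s₂ * (m * ((s₁ : ℝ) / s₂) - k) := by
        push_cast
        by_cases h0 : (s₂ : ℝ) = 0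
        · have : (s₁ : ℝ) = 0 := by
            rw [h0, abs_zero] at hsR
            exact abs_nonpos_iff.1 hsR
          rw [h0, this]; ring
        · field_simp
      rw [e, abs_mul]
      calc |(s₂ : ℝ)| * |(m * ((s₁ : ℝ) / s₂) - k)| ≤ (T * M) * (1 / (N + 1)) :=
            mul_le_mul hs₂ hmk (abs_nonneg _) (by positivity)
        _ ≤ (T * (N + 1)) * (1 / (N + 1)) := by gcongr
        _ = T := by field_simp
    have hErr : ∀ i, |((m * s₁ - k * s₂ : ℤ) : ℝ) * x i - ((m * r₁ i - k * r₂ i : ℤ) : ℝ)|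
        ≤ (ε / T) ^ wt i := by
      intro i
      have e : ((m * s₁ - k * s₂ : ℤ) : ℝ) * x i - ((m * r₁ i - k * r₂ i : ℤ) : ℝ)
        = m * (s₁ * x i - r₁ i) - k * (s₂ * x i - r₂ i) := by push_cast; ring
      rw [e]
      refine (abs_sub _ _).trans ?_
      rw [abs_mul, abs_mul, abs_of_pos hmR]
      have b1 := mul_le_mul (hmNR.trans hNM) (h₁ i) (abs_nonneg _) (by linarith)
      have b2 := mul_le_mul (hkR.trans hNM) (h₂ i) (abs_nonneg _) (by linarith)
      have b3 : M * (T ^ (-wt i) / G) = ε ^ d * T ^ (-wt i) := by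
        rw [hM]; field_simp
      have b4 : 2 * ε ^ d ≤ ε ^ wt i := by
        have c1 : ε ^ d ≤ ε ^ 2 := pow_le_pow_of_le_one hε0.le (by linarith) hd2
        have c2 : ε ≤ ε ^ wt i := by
          have := Real.rpow_le_rpow_of_exponent_ge hε0 (by linarith : ε ≤ 1) (hwt1 i).le
          rwa [Real.rpow_one] at this
        nlinarith
      rw [Real.div_rpow hε0.le hT0.le, div_eq_mul_inv, ← Real.rpow_neg hT0.le]
      have b5 := mul_le_mul_of_nonneg_right b4 (by positivity : 0 ≤ T ^ (-wt i))
      linarith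
    have hne : m * s₁ - k * s₂ ≠ 0 := by
      intro h0
      have := hind m k (fun i => ?_) h0
      · omega
      · have h1 := hErr i
        rw [h0] at h1
        have h2 : (ε / T) ^ wt i < 1 :=
          Real.rpow_lt_one (by positivity) (by rw [div_lt_one hT0]; linarith) (hwt0 i)
        have h3 : |((m * r₁ i - k * r₂ i : ℤ) : ℝ)| < 1 := by
          have := h1.trans_lt h2
          rw [Int.cast_zero, zero_mul, zero_sub, abs_neg] at this
          exact this
        exact Int.abs_lt_one_iff.1 (by exact_mod_cast h3)
    have fin : ∀ (s : ℤ) (r : Fin d → ℤ), 0 < s → |(s : ℝ)| ≤ T →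
        (∀ i, |(s : ℝ) * x i - r i| ≤ (ε / T) ^ wt i) → False := by
      intro s r hs0 hsT hr
      obtain ⟨t, rfl⟩ := Int.eq_ofNat_of_zero_le hs0.le
      have ht : 1 ≤ t := by omega
      have htR : (0 : ℝ) < t := by exact_mod_cast ht
      simp only [Int.cast_natCast] at hsT hr
      rw [abs_of_pos htR] at hsT
      refine hx r t ht hsT (fun i => (hr i).trans ?_)
      apply Real.rpow_le_rpow (by positivity) _ (hwt0 i).le
      gcongr
    rcases lt_or_gt_of_ne hne with h | h
    · refine fin (-(m * s₁ - k * s₂)) (fun i => -(m * r₁ i - k * r₂ i)) (by linarith) ?_ ?_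
      · rw [Int.cast_neg, abs_neg]; exact hS
      · intro i
        have := hErr i
        rw [← abs_neg] at this
        convert this using 2
        push_cast; ring
    · exact fin _ (fun i => m * r₁ i - k * r₂ i) h hS hErr

/-- If `x` admits no `ε/s`-good `w̃`-approximation with denominator up to `R^n`, then the
integer points `(r,s)` in the skewed convex body span a subspace of dimension at most `1`. -/
theorem span_dim_le_one (d : ℕ) (hd : 1 ≤ d) (w wt : Fin d → ℝ)
    (hw0 : ∀ i, 0 < w i) (hw1 : ∀ i, w i < 1) (hwmono : Monotone w)
    (hwt0 : ∀ i, 0 < wt i) (hwt1 : ∀ i, wt i < 1) (hwtmono : Monotone wt)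
    (τ : ℝ) (hτ : 1 < τ)
    (hpos : 0 < τ * w ⟨0, by omega⟩ - wt ⟨0, by omega⟩)
    (hratio : ∀ i : Fin d, (1 + τ * w ⟨0, by omega⟩) / (1 + wt ⟨0, by omega⟩) ≤
      (1 + τ * w i) / (1 + wt i))
    (R : ℝ) (hR : 1 < R) (n : ℕ)
    (ε : ℝ) (hε0 : 0 < ε) (hε1 : ε < 1 / (Nat.factorial (d + 1) : ℝ))
    (hRn : ε ^ (-((d : ℝ) + 1)) ≤ R ^ ((τ * w ⟨0, by omega⟩ - wt ⟨0, by omega⟩) * (n : ℝ)))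
    (x : Fin d → ℝ)
    (hx : ∀ (r : Fin d → ℤ) (s : ℕ), 1 ≤ s → (s : ℝ) ≤ R ^ (n : ℝ) →
      ε / (s : ℝ) < wNorm wt (fun i => (s : ℝ) * x i - (r i : ℝ))) :
    Module.finrank ℝ ↥(Submodule.span ℝ
      {v : (Fin d → ℝ) × ℝ | ∃ (r : Fin d → ℤ) (s : ℤ),
        (∀ i : Fin d, |(s : ℝ) * x i - (r i : ℝ)| ≤
          R ^ (-(wt i - wt ⟨0, by omega⟩) * (n : ℝ)) *
            R ^ (-(τ * w ⟨0, by omega⟩) * (n : ℝ))) ∧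
        |(s : ℝ)| ≤ R ^ ((1 + τ * w ⟨0, by omega⟩ - wt ⟨0, by omega⟩) * (n : ℝ)) * ε ^ d ∧
        v = (fun i => (r i : ℝ), (s : ℝ))}) ≤ 1 := by
  have hR0 : 0 < R := by linarith
  set i0 : Fin d := ⟨0, by omega⟩ with hi0
  set T : ℝ := R ^ (n : ℝ) with hTdef
  set G : ℝ := R ^ ((τ * w i0 - wt i0) * (n : ℝ)) with hGdef
  have hT1 : 1 ≤ T := Real.one_le_rpow hR.le (by positivity)
  have hT0 : 0 < T := by linarith
  have hG0 : 0 < G := by positivity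
  have hε2 : ε < 1 / 2 := by
    refine hε1.trans_le ?_
    apply one_div_le_one_div_of_le (by norm_num)
    have : Nat.factorial 2 ≤ Nat.factorial (d + 1) := Nat.factorial_le (by omega)
    exact_mod_cast this
  have hGε : 1 ≤ G * ε ^ (d + 1) := by
    have h1 := mul_le_mul_of_nonneg_right hRn (by positivity : 0 ≤ ε ^ (d + 1))
    have h2 : ε ^ (-((d : ℝ) + 1)) * ε ^ (d + 1) = 1 := by
      rw [← Real.rpow_natCast, ← Real.rpow_add hε0]; push_cast; simp
    rwa [h2] at h1
  have hx' : ∀ (r : Fin d → ℤ) (s : ℕ), 1 ≤ s → (s : ℝ) ≤ T →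
      (∀ i, |(s : ℝ) * x i - r i| ≤ (ε / s) ^ wt i) → False := by
    intro r s hs hsT hr
    have h1 := hx r s hs hsT
    have hsR : (0 : ℝ) < s := by exact_mod_cast hs
    have : Nonempty (Fin d) := ⟨i0⟩
    have h2 : wNorm wt (fun i => (s : ℝ) * x i - (r i : ℝ)) ≤ ε / s := by
      refine ciSup_le (fun i => ?_)
      have h3 := Real.rpow_le_rpow (abs_nonneg _) (hr i) (one_div_pos.2 (hwt0 i)).le
      rwa [← Real.rpow_mul (by positivity), mul_one_div_cancel (hwt0 i).ne', Real.rpow_one] at h3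
    linarith
  have hB : ∀ i, R ^ (-(wt i - wt i0) * (n : ℝ)) * R ^ (-(τ * w i0) * (n : ℝ))
      = T ^ (-wt i) / G := by
    intro i
    rw [hTdef, hGdef, ← Real.rpow_mul hR0.le, ← Real.rpow_add hR0, ← Real.rpow_sub hR0]
    congr 1; ring
  have hSS : R ^ ((1 + τ * w i0 - wt i0) * (n : ℝ)) * ε ^ d = T * (G * ε ^ d) := by
    rw [hTdef, hGdef, ← mul_assoc, ← Real.rpow_add hR0]
    congr 2; ring
  set A : Set ((Fin d → ℝ) × ℝ) := {v | ∃ (r : Fin d → ℤ) (s : ℤ),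
        (∀ i : Fin d, |(s : ℝ) * x i - (r i : ℝ)| ≤ T ^ (-wt i) / G) ∧
        |(s : ℝ)| ≤ T * (G * ε ^ d) ∧ v = (fun i => (r i : ℝ), (s : ℝ))} with hA
  have hset : {v : (Fin d → ℝ) × ℝ | ∃ (r : Fin d → ℤ) (s : ℤ),
        (∀ i : Fin d, |(s : ℝ) * x i - (r i : ℝ)| ≤
          R ^ (-(wt i - wt i0) * (n : ℝ)) * R ^ (-(τ * w i0) * (n : ℝ))) ∧
        |(s : ℝ)| ≤ R ^ ((1 + τ * w i0 - wt i0) * (n : ℝ)) * ε ^ d ∧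
        v = (fun i => (r i : ℝ), (s : ℝ))} = A := by
    simp only [hB, hSS, hA]
  rw [hset]
  by_cases hz : ∀ v ∈ A, v = 0
  · have : Submodule.span ℝ A = ⊥ := by
      rw [Submodule.span_eq_bot]; exact hz
    rw [this]; simp
  · push Not at hz
    obtain ⟨v, hv, hv0⟩ := hz
    have hsub : A ⊆ (Submodule.span ℝ {v} : Submodule ℝ ((Fin d → ℝ) × ℝ)) := by
      intro u hu
      by_contra hnot
      obtain ⟨r₁, s₁, h₁, hs₁, e₁⟩ := hv
      obtain ⟨r₂, s₂, h₂, hs₂, e₂⟩ := hu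
      have hind : ∀ m k : ℤ, (∀ i, m * r₁ i - k * r₂ i = 0) → m * s₁ - k * s₂ = 0 →
          m = 0 ∧ k = 0 := by
        intro m k hr hs
        have hvec : (m : ℝ) • v = (k : ℝ) • u := by
          rw [e₁, e₂]
          refine Prod.ext (funext fun i => ?_) ?_
          · have : (m : ℝ) * r₁ i - k * r₂ i = 0 := by exact_mod_cast hr i
            simp; linarith
          · have : (m : ℝ) * s₁ - k * s₂ = 0 := by exact_mod_cast hs
            simp; linarith
        have hk : k = 0 := by
          by_contra hk
          have hkR : (k : ℝ) ≠ 0 := by exact_mod_cast hk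
          apply hnot
          refine Submodule.mem_span_singleton.2 ⟨(k : ℝ)⁻¹ * m, ?_⟩
          rw [mul_smul, hvec, smul_smul, inv_mul_cancel₀ hkR, one_smul]
        refine ⟨?_, hk⟩
        rw [hk, Int.cast_zero, zero_smul] at hvec
        rcases smul_eq_zero.1 hvec with h | h
        · exact_mod_cast h
        · exact absurd h hv0
      rcases le_total |s₁| |s₂| with h | h
      · exact core d hd wt hwt0 hwt1 T G hT1 ε hε0 hε2 hGε x hx' r₁ r₂ s₁ s₂ h₁ h₂ hs₁ hs₂ h hind
      · refine core d hd wt hwt0 hwt1 T G hT1 ε hε0 hε2 hGε x hx' r₂ r₁ s₂ s₁ h₂ h₁ hs₂ hs₁ h ?_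
        intro m k hr hs
        have := hind k m (fun i => by linarith [hr i]) (by linarith)
        exact ⟨this.2, this.1⟩
    calc Module.finrank ℝ (Submodule.span ℝ A)
        ≤ Module.finrank ℝ (Submodule.span ℝ {v} : Submodule ℝ ((Fin d → ℝ) × ℝ)) :=
          Submodule.finrank_mono (Submodule.span_le.2 hsub)
      _ = 1 := finrank_span_singleton hv0
      _ ≤ 1 := le_rfl
end

section
/- Let d ≥ 1, let ρ_1,…,ρ_d be reals with 1 < ρ_1 ≤ … ≤ ρ_d, and let ζ_1,…,ζ_d ≥ 1 be reals with (ζ_i log ρ_i)_i nondecreasing. For 1 ≤ h ≤ d, 0 ≤ k ≤ d define f_{h,k}(x) := k + d − h + (log(ρ_1⋯ρ_h) − Σ_{i=1}^k ζ_i log ρ_i) · x / log ρ_1, and f_k(x) := min_{1≤h≤d} f_{h,k}(x) for x ∈ (0,1]. Then for every 0 ≤ k ≤ d, f_k is a piecewise linear function whose slopes, read from left to right, are nonincreasing (on the interval I_h := (log ρ_1/log ρ_{h+1}, log ρ_1/log ρ_h] it equals the affine function f_{h,k}, and the slopes m_{h,k} := (log(ρ_1⋯ρ_h) − Σ_{i=1}^k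 ζ_i log ρ_i)/log ρ_1 satisfy m_{h,k} ≤ m_{h+1,k}); consequently, on any closed interval [a,b] ⊆ (0,1], the minimum of f_k is attained at a or at b. -/
open Real Set

/-- `f_{h,k}(x) = k + d − h + (log(ρ_1⋯ρ_h) − Σ_{i=1}^k ζ_i log ρ_i) x / log ρ_1`. -/
noncomputable def fhk (d : ℕ) (ρ ζ : ℕ → ℝ) (h k : ℕ) (x : ℝ) : ℝ :=
  (k : ℝ) + d - h +
    ((∑ i ∈ Finset.Icc 1 h, Real.log (ρ i)) - ∑ i ∈ Finset.Icc 1 k, ζ i * Real.log (ρ i)) *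
      x / Real.log (ρ 1)

/-- The interval `I_h = (log ρ_1/log ρ_{h+1}, log ρ_1/log ρ_h]`, with `ρ_{d+1} = +∞`. -/
noncomputable def Ih (d : ℕ) (ρ : ℕ → ℝ) (h : ℕ) : Set ℝ :=
  Set.Ioc (if h = d then 0 else Real.log (ρ 1) / Real.log (ρ (h + 1)))
    (Real.log (ρ 1) / Real.log (ρ h))

/-- `f_k = min_{1 ≤ h ≤ d} f_{h,k}`. -/
noncomputable def fk (d : ℕ) (hd : 1 ≤ d) (ρ ζ : ℕ → ℝ) (k : ℕ) (x : ℝ) : ℝ :=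
  (Finset.Icc 1 d).inf' (Finset.nonempty_Icc.mpr hd) (fun h => fhk d ρ ζ h k x)

theorem fk_piecewise_linear_min_at_endpoints (d : ℕ) (hd : 1 ≤ d) (ρ ζ : ℕ → ℝ)
    (hρ1 : 1 < ρ 1) (hρmono : ∀ i, 1 ≤ i → i < d → ρ i ≤ ρ (i + 1))
    (hζ1 : ∀ i, 1 ≤ i → i ≤ d → 1 ≤ ζ i)
    (hζmono : ∀ i, 1 ≤ i → i < d → ζ i * Real.log (ρ i) ≤ ζ (i + 1) * Real.log (ρ (i + 1))) :
    -- the slopes are nonincreasing from left to right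
    (∀ k ≤ d, ∀ h : ℕ, 1 ≤ h → h < d →
      ((∑ i ∈ Finset.Icc 1 h, Real.log (ρ i)) -
          ∑ i ∈ Finset.Icc 1 k, ζ i * Real.log (ρ i)) / Real.log (ρ 1) ≤
        ((∑ i ∈ Finset.Icc 1 (h + 1), Real.log (ρ i)) -
          ∑ i ∈ Finset.Icc 1 k, ζ i * Real.log (ρ i)) / Real.log (ρ 1)) ∧
    -- on `I_h`, the function `f_k` coincides with the affine function `f_{h,k}`
    (∀ k ≤ d, ∀ h : ℕ, 1 ≤ h → h ≤ d → ∀ x ∈ Ih d ρ h,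
      fk d hd ρ ζ k x = fhk d ρ ζ h k x) ∧
    -- consequently, on a closed subinterval of `(0,1]` the minimum is at an endpoint
    (∀ k ≤ d, ∀ a b : ℝ, 0 < a → a ≤ b → b ≤ 1 → ∀ x ∈ Set.Icc a b,
      min (fk d hd ρ ζ k a) (fk d hd ρ ζ k b) ≤ fk d hd ρ ζ k x) := by
  have hL1 : 0 < Real.log (ρ 1) := Real.log_pos hρ1
  have hρge : ∀ i, 1 ≤ i → ∀ j, i ≤ j → j ≤ d → ρ i ≤ ρ j := by
    intro i hi j hij
    induction j, hij using Nat.le_induction with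
    | base => intro _; exact le_rfl
    | succ n hn ih =>
      intro hnd
      exact (ih (by omega)).trans (hρmono n (by omega) (by omega))
  have hgt : ∀ i, 1 ≤ i → i ≤ d → 1 < ρ i := fun i hi hid =>
    lt_of_lt_of_le hρ1 (hρge 1 le_rfl i hi hid)
  have hlogpos : ∀ i, 1 ≤ i → i ≤ d → 0 < Real.log (ρ i) := fun i hi hid =>
    Real.log_pos (hgt i hi hid)
  have hlogmono : ∀ i, 1 ≤ i → ∀ j, i ≤ j → j ≤ d → Real.log (ρ i) ≤ Real.log (ρ j) := by
    intro i hi j hij hjd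
    exact Real.log_le_log (by linarith [hgt i hi (by omega)]) (hρge i hi j hij hjd)
  have hstep : ∀ k h x, fhk d ρ ζ (h + 1) k x =
      fhk d ρ ζ h k x + (Real.log (ρ (h + 1)) * x / Real.log (ρ 1) - 1) := by
    intro k h x
    unfold fhk
    rw [Finset.sum_Icc_succ_top (by omega)]
    push_cast
    ring
  refine ⟨?_, ?_, ?_⟩
  · intro k _ h h1 hhd
    rw [Finset.sum_Icc_succ_top (by omega)]
    apply div_le_div_of_nonneg_right _ hL1.le
    linarith [hlogpos (h + 1) (by omega) (by omega)]
  · intro k _ h h1 hhd x hx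
    obtain ⟨hx1, hx2⟩ := hx
    have hxpos : 0 < x := by
      split_ifs at hx1 with hc
      · exact hx1
      · exact (div_pos hL1 (hlogpos (h + 1) (by omega) (by omega))).trans hx1
    rw [le_div_iff₀ (hlogpos h h1 hhd)] at hx2
    have hup : ∀ j, h ≤ j → j ≤ d → fhk d ρ ζ h k x ≤ fhk d ρ ζ j k x := by
      intro j hj
      induction j, hj using Nat.le_induction with
      | base => intro _; exact le_rfl
      | succ n hn ih =>
        intro hnd
        have h3 := ih (by omega)
        rw [hstep]
        have hc : h ≠ d := by omega
        rw [if_neg hc, div_lt_iff₀ (hlogpos (h + 1) (by omega) (by omega))] at hx1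
        have h4 := hlogmono (h + 1) (by omega) (n + 1) (by omega) hnd
        have h5 : 1 ≤ Real.log (ρ (n + 1)) * x / Real.log (ρ 1) := by
          rw [le_div_iff₀ hL1]
          nlinarith
        linarith
    have hdown : ∀ m j, 1 ≤ j → j + m = h → fhk d ρ ζ h k x ≤ fhk d ρ ζ j k x := by
      intro m
      induction m with
      | zero => intro j _ hj; simp at hj; rw [hj]
      | succ m ih =>
        intro j hj1 hj
        have h3 := ih (j + 1) (by omega) (by omega)
        rw [hstep k j] at h3
        have h4 := hlogmono (j + 1) (by omega) h (by omega) hhd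
        have h5 : Real.log (ρ (j + 1)) * x / Real.log (ρ 1) ≤ 1 := by
          rw [div_le_iff₀ hL1]
          nlinarith
        linarith
    apply le_antisymm
    · exact Finset.inf'_le (fun h => fhk d ρ ζ h k x) (Finset.mem_Icc.mpr ⟨h1, hhd⟩)
    · refine Finset.le_inf' _ _ ?_
      intro j hj
      rw [Finset.mem_Icc] at hj
      rcases le_total h j with hc | hc
      · exact hup j hc hj.2
      · exact hdown (h - j) j hj.1 (by omega)
  · intro k _ a b _ _ _ x hx
    refine Finset.le_inf' _ _ ?_
    intro j hj
    have ha : fk d hd ρ ζ k a ≤ fhk d ρ ζ j k a :=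
      Finset.inf'_le (fun h => fhk d ρ ζ h k a) hj
    have hb : fk d hd ρ ζ k b ≤ fhk d ρ ζ j k b :=
      Finset.inf'_le (fun h => fhk d ρ ζ h k b) hj
    have haff : ∀ y, fhk d ρ ζ j k x = fhk d ρ ζ j k y +
        ((∑ i ∈ Finset.Icc 1 j, Real.log (ρ i)) -
          ∑ i ∈ Finset.Icc 1 k, ζ i * Real.log (ρ i)) / Real.log (ρ 1) * (x - y) := by
      intro y
      unfold fhk
      ring
    have hfa := haff a
    have hfb := haff b
    rcases le_total 0 (((∑ i ∈ Finset.Icc 1 j, Real.log (ρ i)) -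
          ∑ i ∈ Finset.Icc 1 k, ζ i * Real.log (ρ i)) / Real.log (ρ 1)) with hs | hs
    · refine (min_le_left _ _).trans (ha.trans ?_)
      have := mul_nonneg hs (sub_nonneg.mpr hx.1)
      linarith
    · refine (min_le_right _ _).trans (hb.trans ?_)
      have := mul_nonneg_of_nonpos_of_nonpos hs (sub_nonpos.mpr hx.2)
      linarith
end

section
/- Let d ≥ 1, let ρ_1,…,ρ_d be reals with 1 < ρ_1 ≤ … ≤ ρ_d, and let ζ_1,…,ζ_d ≥ 1 be reals with (ζ_i log ρ_i)_i nondecreasing and ζ_1 log ρ_1 ≥ log ρ_1. Define f(x) := Σ_{i=1}^d min{(log ρ_i/log ρ_1) x, 1} + Σ_{i=1}^d max{1 − (ζ_i log ρ_i/log ρ_1) x, 0} for x ∈ [0,1], and f_{h,k}(x) := k + d − h + (log(ρ_1⋯ρ_h) − Σ_{i=1}^k ζ_i log ρ_i) x / log ρ_1. Assume min_{x∈[0,1]} f(x) < d. Then min_{x∈[0,1]} f(x) = min_{1≤k≤d} min_{1≤h≤d} f_{h,k}( log ρ_1 / (ζ_k log ρ_k) ). -/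
open Real Set

/-- `f(x) = Σ_{i=1}^d min{(log ρ_i/log ρ_1)x, 1} + Σ_{i=1}^d max{1 − (ζ_i log ρ_i/log ρ_1)x, 0}`. -/
noncomputable def ff (d : ℕ) (ρ ζ : ℕ → ℝ) (x : ℝ) : ℝ :=
  (∑ i ∈ Finset.Icc 1 d, min ((Real.log (ρ i) / Real.log (ρ 1)) * x) 1) +
    ∑ i ∈ Finset.Icc 1 d, max (1 - (ζ i * Real.log (ρ i) / Real.log (ρ 1)) * x) 0

namespace MinF

/-- The function in terms of normalized sequences. -/
noncomputable def g (d : ℕ) (A B : ℕ → ℝ) (x : ℝ) : ℝ :=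
  (∑ i ∈ Finset.Icc 1 d, min (A i * x) 1) + ∑ i ∈ Finset.Icc 1 d, max (1 - B i * x) 0

lemma mono_of_step (d : ℕ) (A : ℕ → ℝ) (h : ∀ i, 1 ≤ i → i < d → A i ≤ A (i + 1))
    (i j : ℕ) (hi : 1 ≤ i) (hij : i ≤ j) (hj : j ≤ d) : A i ≤ A j := by
  induction j, hij using Nat.le_induction with
  | base => exact le_rfl
  | succ n hn ih => exact (ih (by omega)).trans (h n (by omega) (by omega))

lemma minsum_le (d h : ℕ) (A : ℕ → ℝ) (x : ℝ) (hh : h ≤ d) :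
    ∑ i ∈ Finset.Icc 1 d, min (A i * x) 1 ≤ (∑ i ∈ Finset.Icc 1 h, A i) * x + d - h := by
  induction d, hh using Nat.le_induction with
  | base =>
    rw [Finset.sum_mul, add_sub_cancel_right]
    exact Finset.sum_le_sum fun i _ => min_le_left _ _
  | succ n hn ih =>
    rw [Finset.sum_Icc_succ_top (by omega)]
    have := min_le_right (A (n + 1) * x) 1
    push_cast
    linarith

lemma minsum_eq (d : ℕ) (hd : 1 ≤ d) (A : ℕ → ℝ) (x : ℝ) (hx : 0 ≤ x)
    (hA : ∀ i, 1 ≤ i → i < d → A i ≤ A (i + 1)) (h1 : A 1 * x ≤ 1) :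
    ∃ h, 1 ≤ h ∧ h ≤ d ∧
      ∑ i ∈ Finset.Icc 1 d, min (A i * x) 1 = (∑ i ∈ Finset.Icc 1 h, A i) * x + d - h := by
  induction d, hd using Nat.le_induction with
  | base => exact ⟨1, le_rfl, le_rfl, by simp [h1]⟩
  | succ n hn ih =>
    by_cases hc : A (n + 1) * x ≤ 1
    · refine ⟨n + 1, by omega, le_rfl, ?_⟩
      rw [Finset.sum_mul, add_sub_cancel_right]
      refine Finset.sum_congr rfl fun i hi => ?_
      rw [Finset.mem_Icc] at hi
      exact min_eq_left ((mul_le_mul_of_nonneg_right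
        (mono_of_step (n + 1) A hA i (n + 1) hi.1 hi.2 le_rfl) hx).trans hc)
    · obtain ⟨h, a, b, c⟩ := ih (fun i h1 h2 => hA i h1 (by omega))
      refine ⟨h, a, by omega, ?_⟩
      rw [Finset.sum_Icc_succ_top (by omega), c, min_eq_right (not_le.mp hc).le]
      push_cast
      ring

lemma maxsum_eq (d k : ℕ) (hk : 1 ≤ k) (hkd : k ≤ d) (B : ℕ → ℝ) (x : ℝ)
    (h1 : ∀ i, 1 ≤ i → i ≤ k → B i * x ≤ 1) (h2 : ∀ i, k < i → i ≤ d → 1 ≤ B i * x) :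
    ∑ i ∈ Finset.Icc 1 d, max (1 - B i * x) 0 = k - (∑ i ∈ Finset.Icc 1 k, B i) * x := by
  induction d, hkd using Nat.le_induction with
  | base =>
    have : ∑ i ∈ Finset.Icc 1 k, max (1 - B i * x) 0 = ∑ i ∈ Finset.Icc 1 k, (1 - B i * x) := by
      refine Finset.sum_congr rfl fun i hi => ?_
      rw [Finset.mem_Icc] at hi
      exact max_eq_left (by linarith [h1 i hi.1 hi.2])
    rw [this, Finset.sum_sub_distrib, Finset.sum_mul]
    simp
  | succ n hn ih =>
    rw [Finset.sum_Icc_succ_top (by omega), ih (fun i a b => h2 i a (by omega)),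
      max_eq_right (by linarith [h2 (n + 1) (by omega) le_rfl]), add_zero]

lemma g_lower (d : ℕ) (hd : 1 ≤ d) (A B : ℕ → ℝ) (hA0 : ∀ i, 1 ≤ i → i ≤ d → 0 ≤ A i)
    (hAB : ∀ i, 1 ≤ i → i ≤ d → A i ≤ B i) (hB0 : ∀ i, 1 ≤ i → i ≤ d → 0 < B i)
    (hB : ∀ i, 1 ≤ i → i < d → B i ≤ B (i + 1)) (x : ℝ) (hx : 0 ≤ x) :
    ∃ k, 1 ≤ k ∧ k ≤ d ∧ g d A B (1 / B k) ≤ g d A B x := by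
  have hm := mono_of_step d B hB
  by_cases hc1 : 1 ≤ B 1 * x
  · refine ⟨1, le_rfl, hd, ?_⟩
    have hb := hB0 1 le_rfl hd
    have hle : 1 / B 1 ≤ x := by rw [div_le_iff₀ hb]; linarith
    refine add_le_add (Finset.sum_le_sum fun i hi => ?_) (Finset.sum_le_sum fun i hi => ?_) <;>
      rw [Finset.mem_Icc] at hi
    · exact min_le_min_right _ (mul_le_mul_of_nonneg_left hle (hA0 i hi.1 hi.2))
    · have : 1 ≤ B i * (1 / B 1) := by
        rw [mul_one_div, le_div_iff₀ hb]; linarith [hm 1 i le_rfl hi.1 hi.2]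
      rw [max_eq_right (by linarith)]
      exact le_max_right _ _
  by_cases hcd : B d * x ≤ 1
  · refine ⟨d, hd, le_rfl, ?_⟩
    have hb := hB0 d hd le_rfl
    have hle : x ≤ 1 / B d := by rw [le_div_iff₀ hb]; linarith
    unfold g
    rw [← Finset.sum_add_distrib, ← Finset.sum_add_distrib]
    refine Finset.sum_le_sum fun i hi => ?_
    rw [Finset.mem_Icc] at hi
    have h1 : B i * (1 / B d) ≤ 1 := by
      rw [mul_one_div, div_le_one hb]; exact hm i d hi.1 hi.2 le_rfl
    have h2 : B i * x ≤ B i * (1 / B d) := mul_le_mul_of_nonneg_left hle (hB0 i hi.1 hi.2).le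
    have h3 : A i * x ≤ B i * x := mul_le_mul_of_nonneg_right (hAB i hi.1 hi.2) hx
    have h4 := min_le_left (A i * (1 / B d)) 1
    rw [max_eq_left (by linarith), max_eq_left (by linarith), min_eq_left (a := A i * x) (by linarith)]
    nlinarith [mul_nonneg (sub_nonneg.2 (hAB i hi.1 hi.2)) (sub_nonneg.2 hle)]
  push Not at hc1 hcd
  have hex : ∃ n, 1 ≤ n ∧ 1 < B n * x := ⟨d, hd, hcd⟩
  classical
  obtain ⟨k, hk1, hkd, hkl, hkr⟩ : ∃ k, 1 ≤ k ∧ k < d ∧ B k * x ≤ 1 ∧ 1 < B (k + 1) * x := by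
    have hs := Nat.find_spec hex
    have hle : Nat.find hex ≤ d := Nat.find_min' hex ⟨hd, hcd⟩
    have hne : Nat.find hex ≠ 1 := fun h => by rw [h] at hs; linarith [hs.2]
    have hlt := Nat.find_min hex (m := Nat.find hex - 1) (by omega)
    refine ⟨Nat.find hex - 1, by omega, by omega, ?_, ?_⟩
    · by_contra hcon
      exact hlt ⟨by omega, not_le.mp hcon⟩
    · rw [Nat.sub_add_cancel hs.1]; exact hs.2
  have hb := hB0 k hk1 hkd.le
  have hb' := hB0 (k + 1) (by omega) hkd
  have hux : 1 / B (k + 1) ≤ x := by rw [div_le_iff₀ hb']; linarith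
  have hxv : x ≤ 1 / B k := by rw [le_div_iff₀ hb]; linarith
  have hu : ∀ i, k < i → i ≤ d → 1 ≤ B i * (1 / B (k + 1)) := fun i h1 h2 => by
    rw [mul_one_div, le_div_iff₀ hb', one_mul]; exact hm _ _ (by omega) h1 h2
  have hv : ∀ i, 1 ≤ i → i ≤ k → B i * (1 / B k) ≤ 1 := fun i h1 h2 => by
    rw [mul_one_div, div_le_one hb]; exact hm _ _ h1 h2 hkd.le
  obtain ⟨s, t, hs, ht, hst, hxe⟩ : ∃ s t : ℝ, 0 ≤ s ∧ 0 ≤ t ∧ s + t = 1 ∧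
      s * (1 / B (k + 1)) + t * (1 / B k) = x := by
    have hmem : x ∈ segment ℝ (1 / B (k + 1)) (1 / B k) := by
      rw [segment_eq_Icc (hux.trans hxv)]; exact ⟨hux, hxv⟩
    obtain ⟨s, t, hs, ht, hst, h⟩ := hmem
    exact ⟨s, t, hs, ht, hst, h⟩
  generalize hU : 1 / B (k + 1) = u at *
  generalize hV : 1 / B k = v at *
  have key : s * g d A B u + t * g d A B v ≤ g d A B x := by
    unfold g
    rw [mul_add, mul_add, add_add_add_comm]
    simp only [Finset.mul_sum]
    rw [← Finset.sum_add_distrib, ← Finset.sum_add_distrib]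
    refine add_le_add (Finset.sum_le_sum fun i hi => ?_) (Finset.sum_le_sum fun i hi => ?_) <;>
      rw [Finset.mem_Icc] at hi
    · have e1 := mul_le_mul_of_nonneg_left (min_le_left (A i * u) 1) hs
      have e2 := mul_le_mul_of_nonneg_left (min_le_right (A i * u) 1) hs
      have e3 := mul_le_mul_of_nonneg_left (min_le_left (A i * v) 1) ht
      have e4 := mul_le_mul_of_nonneg_left (min_le_right (A i * v) 1) ht
      refine le_min ?_ (by linarith)
      rw [← hxe]
      linarith
    · by_cases hik : i ≤ k
      · have e1 := hv i hi.1 hik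
        have e2 := mul_le_mul_of_nonneg_left (hux.trans hxv) (hB0 i hi.1 hi.2).le
        rw [max_eq_left (by linarith), max_eq_left (by linarith)]
        refine le_trans (le_of_eq ?_) (le_max_left _ _)
        rw [← hxe]
        linear_combination hst
      · have e1 := hu i (by omega) hi.2
        have e2 := mul_le_mul_of_nonneg_left (hux.trans hxv) (hB0 i hi.1 hi.2).le
        rw [max_eq_right (by linarith), max_eq_right (by linarith)]
        refine le_trans (le_of_eq ?_) (le_max_right _ _)
        ring
  by_cases hc : g d A B u ≤ g d A B x
  · exact ⟨k + 1, by omega, hkd, by rw [hU]; exact hc⟩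
  · refine ⟨k, hk1, hkd.le, ?_⟩
    rw [hV]
    by_contra hc'
    push Not at hc hc'
    have : s * g d A B x + t * g d A B x = g d A B x := by rw [← add_mul, hst, one_mul]
    rcases hs.eq_or_lt with h0 | h0
    · have : t = 1 := by linarith
      subst this
      subst h0
      linarith
    · linarith [mul_lt_mul_of_pos_left hc h0, mul_le_mul_of_nonneg_left hc'.le ht]

end MinF

theorem min_f_eq_min_over_breakpoints (d : ℕ) (hd : 1 ≤ d) (ρ ζ : ℕ → ℝ)
    (hρ1 : 1 < ρ 1) (hρmono : ∀ i, 1 ≤ i → i < d → ρ i ≤ ρ (i + 1))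
    (hζ1 : ∀ i, 1 ≤ i → i ≤ d → 1 ≤ ζ i)
    (hζmono : ∀ i, 1 ≤ i → i < d → ζ i * Real.log (ρ i) ≤ ζ (i + 1) * Real.log (ρ (i + 1)))
    (hζρ : Real.log (ρ 1) ≤ ζ 1 * Real.log (ρ 1))
    (hmin : sInf (ff d ρ ζ '' Set.Icc (0 : ℝ) 1) < d) :
    sInf (ff d ρ ζ '' Set.Icc (0 : ℝ) 1) =
      (Finset.Icc 1 d).inf' (Finset.nonempty_Icc.mpr hd) (fun k =>
        (Finset.Icc 1 d).inf' (Finset.nonempty_Icc.mpr hd) (fun h =>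
          fhk d ρ ζ h k (Real.log (ρ 1) / (ζ k * Real.log (ρ k))))) := by
  have hL1 : 0 < Real.log (ρ 1) := Real.log_pos hρ1
  have hρ : ∀ i, 1 ≤ i → i ≤ d → 1 < ρ i := fun i h1 h2 =>
    hρ1.trans_le (MinF.mono_of_step d ρ hρmono 1 i le_rfl h1 h2)
  have hL : ∀ i, 1 ≤ i → i ≤ d → 0 < Real.log (ρ i) := fun i h1 h2 => Real.log_pos (hρ i h1 h2)
  set A : ℕ → ℝ := fun i => Real.log (ρ i) / Real.log (ρ 1) with hAdef
  set B : ℕ → ℝ := fun i => ζ i * Real.log (ρ i) / Real.log (ρ 1) with hBdef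
  have hff : ff d ρ ζ = MinF.g d A B := rfl
  have hfhk : ∀ h k x, fhk d ρ ζ h k x =
      k + d - h + (∑ i ∈ Finset.Icc 1 h, A i - ∑ i ∈ Finset.Icc 1 k, B i) * x := by
    intro h k x
    simp only [fhk, hAdef, hBdef]
    rw [← Finset.sum_div, ← Finset.sum_div]
    ring
  have hpt : ∀ k, Real.log (ρ 1) / (ζ k * Real.log (ρ k)) = 1 / B k := fun k => by
    simp only [hBdef, one_div_div]
  have hA0 : ∀ i, 1 ≤ i → i ≤ d → 0 ≤ A i := fun i h1 h2 => (div_pos (hL i h1 h2) hL1).le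
  have hAB : ∀ i, 1 ≤ i → i ≤ d → A i ≤ B i := fun i h1 h2 =>
    div_le_div_of_nonneg_right (le_mul_of_one_le_left (hL i h1 h2).le (hζ1 i h1 h2)) hL1.le
  have hB0 : ∀ i, 1 ≤ i → i ≤ d → 0 < B i := fun i h1 h2 =>
    div_pos (mul_pos (by linarith [hζ1 i h1 h2]) (hL i h1 h2)) hL1
  have hB : ∀ i, 1 ≤ i → i < d → B i ≤ B (i + 1) := fun i h1 h2 =>
    div_le_div_of_nonneg_right (hζmono i h1 h2) hL1.le
  have hA : ∀ i, 1 ≤ i → i < d → A i ≤ A (i + 1) := fun i h1 h2 =>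
    div_le_div_of_nonneg_right (Real.log_le_log (by linarith [hρ i h1 h2.le]) (hρmono i h1 h2)) hL1.le
  have hA1 : A 1 = 1 := div_self hL1.ne'
  have hB1 : ∀ k, 1 ≤ k → k ≤ d → 1 ≤ B k := fun k h1 h2 =>
    ((hA1 ▸ hAB 1 le_rfl hd : 1 ≤ B 1)).trans (MinF.mono_of_step d B hB 1 k le_rfl h1 h2)
  have hx0 : ∀ k, 1 ≤ k → k ≤ d → 0 ≤ 1 / B k := fun k h1 h2 => (one_div_pos.2 (hB0 k h1 h2)).le
  have hx1 : ∀ k, 1 ≤ k → k ≤ d → 1 / B k ≤ 1 := fun k h1 h2 => by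
    rw [div_le_one (hB0 k h1 h2)]; exact hB1 k h1 h2
  have hmax : ∀ k, 1 ≤ k → k ≤ d → ∑ i ∈ Finset.Icc 1 d, max (1 - B i * (1 / B k)) 0 =
      k - (∑ i ∈ Finset.Icc 1 k, B i) * (1 / B k) := fun k h1 h2 => by
    refine MinF.maxsum_eq d k h1 h2 B _ (fun i a b => ?_) (fun i a b => ?_)
    · rw [mul_one_div, div_le_one (hB0 k h1 h2)]
      exact MinF.mono_of_step d B hB i k a b h2
    · rw [mul_one_div, le_div_iff₀ (hB0 k h1 h2), one_mul]
      exact MinF.mono_of_step d B hB k i h1 a.le b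
  have hbdd : BddBelow (ff d ρ ζ '' Set.Icc (0 : ℝ) 1) := by
    refine ⟨0, ?_⟩
    rintro _ ⟨x, hx, rfl⟩
    refine add_nonneg (Finset.sum_nonneg fun i hi => ?_)
      (Finset.sum_nonneg fun i _ => le_max_right _ _)
    rw [Finset.mem_Icc] at hi
    exact le_min (mul_nonneg (hA0 i hi.1 hi.2) hx.1) zero_le_one
  apply le_antisymm
  · refine Finset.le_inf' _ _ fun k hk => Finset.le_inf' _ _ fun h hh => ?_
    rw [Finset.mem_Icc] at hk hh
    rw [hpt, hfhk]
    refine (csInf_le hbdd ⟨1 / B k, ⟨hx0 k hk.1 hk.2, hx1 k hk.1 hk.2⟩, rfl⟩).trans ?_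
    rw [hff, MinF.g, hmax k hk.1 hk.2]
    linarith [MinF.minsum_le d h A (1 / B k) hh.2]
  · refine le_csInf ((Set.nonempty_Icc.2 zero_le_one).image _) ?_
    rintro _ ⟨x, hx, rfl⟩
    obtain ⟨k, hk1, hk2, hk⟩ := MinF.g_lower d hd A B hA0 hAB hB0 hB x hx.1
    obtain ⟨h, hh1, hh2, hh⟩ := MinF.minsum_eq d hd A (1 / B k) (hx0 k hk1 hk2) hA
      (by rw [hA1, one_mul]; exact hx1 k hk1 hk2)
    rw [hff]
    refine le_trans ?_ hk
    refine (Finset.inf'_le _ (Finset.mem_Icc.2 ⟨hk1, hk2⟩)).trans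
      ((Finset.inf'_le _ (Finset.mem_Icc.2 ⟨hh1, hh2⟩)).trans ?_)
    rw [hpt, hfhk, MinF.g, hmax k hk1 hk2, hh]
    linarith
end
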